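/- arXiv:1908.01905 — 3 statements merged into one kernel-verified Lean document; each statement's English description precedes it below -/
import Mathlib

section
/- For every smooth function f : ℝ³∖{0} → ℂ, every x ≠ 0, and every index i ∈ {1,2,3}, one has T(Lᵢf)(x) = Lᵢ(Tf)(x) and T(Rᵢf)(x) = Rᵢ(Tf)(x); that is, each angular momentum operator Lᵢ and each Runge–Lenz operator Rᵢ commutes with the rescaled Schrödinger operator T on smooth functions on ℝ³∖{0}. -/
noncomputable section

/-- Euclidean 3-space. -/
abbrev E3 : Type := EuclideanSpace ℝ (Fin 3)

/-- The `i`-th partial derivative of a complex-valued function on `E3`. -/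
def pd (i : Fin 3) (f : E3 → ℂ) (x : E3) : ℂ :=
  fderiv ℝ f x (EuclideanSpace.single i 1)

/-- Angular momentum operator `L₁ = x₂∂₃ − x₃∂₂` (0-indexed coordinates). -/
def L1 (f : E3 → ℂ) (x : E3) : ℂ := (x 1 : ℂ) * pd 2 f x - (x 2 : ℂ) * pd 1 f x

/-- Angular momentum operator `L₂ = x₃∂₁ − x₁∂₃`. -/
def L2 (f : E3 → ℂ) (x : E3) : ℂ := (x 2 : ℂ) * pd 0 f x - (x 0 : ℂ) * pd 2 f x

/-- Angular momentum operator `L₃ = x₁∂₂ − x₂∂₁`. -/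
def L3 (f : E3 → ℂ) (x : E3) : ℂ := (x 0 : ℂ) * pd 1 f x - (x 1 : ℂ) * pd 0 f x

/-- Runge–Lenz operator `R₁ = i(L₃∂₂ − L₂∂₃ − ∂₁ + γx₁/r)`. -/
def R1 (γ : ℝ) (f : E3 → ℂ) (x : E3) : ℂ :=
  Complex.I * (L3 (pd 1 f) x - L2 (pd 2 f) x - pd 0 f x + ((γ * x 0 / ‖x‖ : ℝ) : ℂ) * f x)

/-- Runge–Lenz operator `R₂ = i(L₁∂₃ − L₃∂₁ − ∂₂ + γx₂/r)`. -/
def R2 (γ : ℝ) (f : E3 → ℂ) (x : E3) : ℂ :=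
  Complex.I * (L1 (pd 2 f) x - L3 (pd 0 f) x - pd 1 f x + ((γ * x 1 / ‖x‖ : ℝ) : ℂ) * f x)

/-- Runge–Lenz operator `R₃ = i(L₂∂₁ − L₁∂₂ − ∂₃ + γx₃/r)`. -/
def R3 (γ : ℝ) (f : E3 → ℂ) (x : E3) : ℂ :=
  Complex.I * (L2 (pd 0 f) x - L1 (pd 1 f) x - pd 2 f x + ((γ * x 2 / ‖x‖ : ℝ) : ℂ) * f x)

/-- The rescaled Schrödinger operator `T = −Δ − 2γ/r`. -/
def Tsch (γ : ℝ) (f : E3 → ℂ) (x : E3) : ℂ :=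
  -(pd 0 (pd 0 f) x + pd 1 (pd 1 f) x + pd 2 (pd 2 f) x) - ((2 * γ / ‖x‖ : ℝ) : ℂ) * f x

/-- In a commutative algebra with three commuting derivations `D₀, D₁, D₂`, coordinates `X, Y, Z`
and an inverse radius `u`, the Schrödinger operator commutes with one angular momentum operator
and with one Runge–Lenz operator; the other two follow by cyclic permutation. -/
theorem derivation_schrodinger_commute {A : Type*} [CommRing A] [Algebra ℂ A]
    (D₀ D₁ D₂ : Derivation ℂ A A) (X Y Z u : A) (c J : ℂ)
    (h10 : ∀ g, D₁ (D₀ g) = D₀ (D₁ g)) (h20 : ∀ g, D₂ (D₀ g) = D₀ (D₂ g))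
    (h21 : ∀ g, D₂ (D₁ g) = D₁ (D₂ g))
    (h0X : D₀ X = 1) (h0Y : D₀ Y = 0) (h0Z : D₀ Z = 0)
    (h1X : D₁ X = 0) (h1Y : D₁ Y = 1) (h1Z : D₁ Z = 0)
    (h2X : D₂ X = 0) (h2Y : D₂ Y = 0) (h2Z : D₂ Z = 1)
    (h0u : D₀ u = -(X * u ^ 3)) (h1u : D₁ u = -(Y * u ^ 3)) (h2u : D₂ u = -(Z * u ^ 3))
    (hu : u ^ 2 * (X ^ 2 + Y ^ 2 + Z ^ 2) = 1) (g : A)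
    (T L M N R : A → A)
    (hT : ∀ g, T g = -(D₀ (D₀ g) + D₁ (D₁ g) + D₂ (D₂ g)) - algebraMap ℂ A (2 * c) * u * g)
    (hL : ∀ g, L g = Y * D₂ g - Z * D₁ g)
    (hM : ∀ g, M g = Z * D₀ g - X * D₂ g)
    (hN : ∀ g, N g = X * D₁ g - Y * D₀ g)
    (hR : ∀ g, R g = algebraMap ℂ A J *
      (N (D₁ g) - M (D₂ g) - D₀ g + algebraMap ℂ A c * X * u * g)) :
    T (L g) = L (T g) ∧ T (R g) = R (T g) := by
  constructor
  · simp only [hT, hL, map_add, map_sub, map_neg, Derivation.leibniz,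
      Derivation.map_algebraMap, smul_eq_mul, h10, h20, h21, h0Y, h0Z, h1Y, h1Z,
      h2Y, h2Z, h1u, h2u, map_zero, Derivation.map_one_eq_zero]
    ring
  · simp only [hT, hM, hN, hR, map_add, map_sub, map_neg, Derivation.leibniz,
      Derivation.leibniz_pow, nsmul_eq_mul, Nat.cast_ofNat,
      Derivation.map_algebraMap, smul_eq_mul, h10, h20, h21, h0X, h0Y, h0Z, h1X, h1Y, h1Z,
      h2X, h2Y, h2Z, h0u, h1u, h2u, map_zero, Derivation.map_one_eq_zero]
    simp only [map_mul, map_ofNat]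
    linear_combination algebraMap ℂ A J * algebraMap ℂ A c *
      (2 * u * D₀ g - 3 * X * u ^ 3 * g) * hu

theorem isOpen_punctured : IsOpen {x : E3 | x ≠ 0} := isOpen_ne

theorem pd_congr {f g : E3 → ℂ} (h : Set.EqOn f g {x | x ≠ 0}) (i : Fin 3) :
    Set.EqOn (pd i f) (pd i g) {x | x ≠ 0} := fun x hx => by
  simp only [pd, (h.eventuallyEq_of_mem (isOpen_punctured.mem_nhds hx)).fderiv_eq]

theorem ContDiffOn.differentiableAt_of_ne_zero {f : E3 → ℂ}
    (hf : ContDiffOn ℝ (⊤ : ℕ∞) f {x | x ≠ 0}) {x : E3} (hx : x ≠ 0) :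
    DifferentiableAt ℝ f x :=
  (hf.contDiffAt (isOpen_punctured.mem_nhds hx)).differentiableAt (by simp)

theorem ContDiffOn.pd {f : E3 → ℂ} (hf : ContDiffOn ℝ (⊤ : ℕ∞) f {x | x ≠ 0}) (i : Fin 3) :
    ContDiffOn ℝ (⊤ : ℕ∞) (pd i f) {x | x ≠ 0} :=
  (hf.fderiv_of_isOpen isOpen_punctured (by simp)).clm_apply contDiffOn_const

theorem pd_add {f g : E3 → ℂ} {x : E3} (hf : DifferentiableAt ℝ f x)
    (hg : DifferentiableAt ℝ g x) (i : Fin 3) :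
    pd i (fun y => f y + g y) x = pd i f x + pd i g x := by
  simp [pd, fderiv_fun_add hf hg]

theorem pd_mul {f g : E3 → ℂ} {x : E3} (hf : DifferentiableAt ℝ f x)
    (hg : DifferentiableAt ℝ g x) (i : Fin 3) :
    pd i (fun y => f y * g y) x = f x * pd i g x + g x * pd i f x := by
  simp [pd, fderiv_fun_mul hf hg]

theorem pd_comm {f : E3 → ℂ} (hf : ContDiffOn ℝ (⊤ : ℕ∞) f {x | x ≠ 0}) {x : E3} (hx : x ≠ 0)
    (i j : Fin 3) : pd i (pd j f) x = pd j (pd i f) x := by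
  have hc := hf.contDiffAt (isOpen_punctured.mem_nhds hx)
  have hd : DifferentiableAt ℝ (fderiv ℝ f) x :=
    (hc.fderiv_right (m := 1) (WithTop.coe_le_coe.2 (le_top : (2 : ℕ∞) ≤ ⊤))).differentiableAt
      (by simp)
  have key : ∀ k l : Fin 3, pd k (pd l f) x =
      fderiv ℝ (fderiv ℝ f) x (EuclideanSpace.single k 1) (EuclideanSpace.single l 1) := by
    intro k l
    change fderiv ℝ (fun y => fderiv ℝ f y (EuclideanSpace.single l 1)) x _ = _
    rw [fderiv_clm_apply hd (differentiableAt_const _)]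
    simp
  rw [key, key]
  exact (hc.isSymmSndFDerivAt (by simpa using WithTop.coe_le_coe.2 (le_top : (2 : ℕ∞) ≤ ⊤))).eq _ _

/-- Extension by zero of a function on punctured space. -/
def extendZero (g : {x : E3 // x ≠ 0} → ℂ) : E3 → ℂ := Function.extend Subtype.val g 0

theorem extendZero_apply (g : {x : E3 // x ≠ 0} → ℂ) {x : E3} (hx : x ≠ 0) :
    extendZero g x = g ⟨x, hx⟩ :=
  Subtype.val_injective.extend_apply g 0 ⟨x, hx⟩

theorem extendZero_eqOn (f : E3 → ℂ) :
    Set.EqOn (extendZero fun p => f p) f {x | x ≠ 0} := fun _ hx => extendZero_apply _ hx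

/-- The algebra of smooth complex functions on punctured space. -/
def puncturedSmooth : Subalgebra ℂ ({x : E3 // x ≠ 0} → ℂ) where
  carrier := {g | ContDiffOn ℝ (⊤ : ℕ∞) (extendZero g) {x | x ≠ 0}}
  mul_mem' {a b} ha hb := (ContDiffOn.mul ha hb).congr fun x hx => by
    simp [extendZero_apply _ hx]
  add_mem' {a b} ha hb := (ContDiffOn.add ha hb).congr fun x hx => by
    simp [extendZero_apply _ hx]
  algebraMap_mem' c := (contDiffOn_const (c := c)).congr fun x hx => by
    simp [extendZero_apply _ hx]

theorem puncturedSmooth.contDiffOn_extendZero (g : puncturedSmooth) :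
    ContDiffOn ℝ (⊤ : ℕ∞) (extendZero g) {x | x ≠ 0} := g.2

/-- A function on `E3` smooth away from the origin, as an element of `puncturedSmooth`. -/
def puncturedSmooth.ofSmooth (f : E3 → ℂ) (hf : ContDiffOn ℝ (⊤ : ℕ∞) f {x | x ≠ 0}) :
    puncturedSmooth :=
  ⟨fun p => f p, hf.congr (extendZero_eqOn f)⟩

/-- The partial derivative as a derivation of `puncturedSmooth`. -/
def puncturedSmooth.pd (i : Fin 3) : Derivation ℂ puncturedSmooth puncturedSmooth :=
  Derivation.mk'
    { toFun g := ofSmooth (_root_.pd i (extendZero g)) ((contDiffOn_extendZero g).pd i)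
      map_add' a b := Subtype.ext <| funext fun p => by
        have h : Set.EqOn (extendZero (a + b : puncturedSmooth))
            (fun y => extendZero a y + extendZero b y) {x | x ≠ 0} := fun x hx => by
          simp [extendZero_apply _ hx]
        exact (pd_congr h i p.2).trans
          (pd_add ((contDiffOn_extendZero a).differentiableAt_of_ne_zero p.2)
            ((contDiffOn_extendZero b).differentiableAt_of_ne_zero p.2) i)
      map_smul' c a := Subtype.ext <| funext fun p => by
        have h : Set.EqOn (extendZero (c • a : puncturedSmooth))
            (fun y => c * extendZero a y) {x | x ≠ 0} := fun x hx => by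
          simp [extendZero_apply _ hx]
        refine (pd_congr h i p.2).trans ((pd_mul (differentiableAt_const c)
          ((contDiffOn_extendZero a).differentiableAt_of_ne_zero p.2) i).trans ?_)
        simp [_root_.pd, ofSmooth] }
    fun a b => Subtype.ext <| funext fun p => by
      have h : Set.EqOn (extendZero (a * b : puncturedSmooth))
          (fun y => extendZero a y * extendZero b y) {x | x ≠ 0} := fun x hx => by
        simp [extendZero_apply _ hx]
      refine (pd_congr h i p.2).trans ((pd_mul
        ((contDiffOn_extendZero a).differentiableAt_of_ne_zero p.2)
        ((contDiffOn_extendZero b).differentiableAt_of_ne_zero p.2) i).trans ?_)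
      simp [extendZero_apply _ p.2, ofSmooth]

theorem puncturedSmooth.pd_ofSmooth (i : Fin 3) {f : E3 → ℂ}
    (hf : ContDiffOn ℝ (⊤ : ℕ∞) f {x | x ≠ 0}) :
    puncturedSmooth.pd i (ofSmooth f hf) = ofSmooth (_root_.pd i f) (hf.pd i) :=
  Subtype.ext <| funext fun p => pd_congr (extendZero_eqOn f) i p.2

theorem puncturedSmooth.ofSmooth_extendZero (g : puncturedSmooth) :
    ofSmooth (extendZero g) (contDiffOn_extendZero g) = g :=
  Subtype.ext <| funext fun p => extendZero_apply _ p.2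

theorem puncturedSmooth.pd_comm (i j : Fin 3) (g : puncturedSmooth) :
    puncturedSmooth.pd i (puncturedSmooth.pd j g) =
      puncturedSmooth.pd j (puncturedSmooth.pd i g) := by
  rw [← ofSmooth_extendZero g]
  simp only [pd_ofSmooth]
  exact Subtype.ext <| funext fun p => _root_.pd_comm (contDiffOn_extendZero g) p.2 i j

theorem contDiff_coord (i : Fin 3) : ContDiff ℝ (⊤ : ℕ∞) fun x : E3 => (x i : ℂ) :=
  Complex.ofRealCLM.contDiff.comp (EuclideanSpace.proj i : E3 →L[ℝ] ℝ).contDiff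

theorem pd_coord (i j : Fin 3) (x : E3) :
    pd i (fun x : E3 => (x j : ℂ)) x = if j = i then 1 else 0 := by
  have h : HasFDerivAt (fun x : E3 => (x j : ℂ))
      (Complex.ofRealCLM.comp (EuclideanSpace.proj j : E3 →L[ℝ] ℝ)) x :=
    (Complex.ofRealCLM.comp (EuclideanSpace.proj j : E3 →L[ℝ] ℝ)).hasFDerivAt
  rw [pd, h.fderiv]
  by_cases hij : j = i <;> simp [hij]

theorem contDiffOn_inv_norm :
    ContDiffOn ℝ (⊤ : ℕ∞) (fun x : E3 => ((‖x‖⁻¹ : ℝ) : ℂ)) {x | x ≠ 0} :=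
  fun x hx => (Complex.ofRealCLM.contDiff.contDiffAt.comp x
    ((contDiffAt_norm ℝ hx).inv (norm_ne_zero_iff.2 hx))).contDiffWithinAt

theorem pd_inv_norm (i : Fin 3) {x : E3} (hx : x ≠ 0) :
    pd i (fun x : E3 => ((‖x‖⁻¹ : ℝ) : ℂ)) x = -((x i : ℂ) * ((‖x‖⁻¹ : ℝ) : ℂ) ^ 3) := by
  have hn : ‖x‖ ≠ 0 := norm_ne_zero_iff.2 hx
  have h1 : HasFDerivAt (fun x : E3 => ‖x‖) (‖x‖⁻¹ • innerSL ℝ x) x := by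
    have h := ((hasStrictFDerivAt_norm_sq x).hasFDerivAt).sqrt (by positivity)
    simp only [Real.sqrt_sq (norm_nonneg _)] at h
    refine h.congr_fderiv (ContinuousLinearMap.ext fun v => ?_)
    simp
    field_simp
  have h2 := Complex.ofRealCLM.hasFDerivAt.comp x ((hasDerivAt_inv hn).comp_hasFDerivAt x h1)
  have h3 : fderiv ℝ (fun x : E3 => ((‖x‖⁻¹ : ℝ) : ℂ)) x = _ := h2.fderiv
  rw [pd, h3]
  simp [EuclideanSpace.inner_single_right]
  field_simp

namespace puncturedSmooth

/-- The coordinate functions. -/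
def coord (i : Fin 3) : puncturedSmooth := ofSmooth _ (contDiff_coord i).contDiffOn

/-- The inverse radius. -/
def invNorm : puncturedSmooth := ofSmooth _ contDiffOn_inv_norm

/-- Angular momentum operators on `puncturedSmooth`. -/
def angular (i : Fin 3) (g : puncturedSmooth) : puncturedSmooth :=
  coord (i + 1) * pd (i + 2) g - coord (i + 2) * pd (i + 1) g

/-- Runge–Lenz operators on `puncturedSmooth`. -/
def rungeLenz (c : ℂ) (i : Fin 3) (g : puncturedSmooth) : puncturedSmooth :=
  algebraMap ℂ _ Complex.I * (angular (i + 2) (pd (i + 1) g) - angular (i + 1) (pd (i + 2) g)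
    - pd i g + algebraMap ℂ _ c * coord i * invNorm * g)

/-- The rescaled Schrödinger operator on `puncturedSmooth`. -/
def schrodinger (c : ℂ) (g : puncturedSmooth) : puncturedSmooth :=
  -(pd 0 (pd 0 g) + pd 1 (pd 1 g) + pd 2 (pd 2 g)) - algebraMap ℂ _ (2 * c) * invNorm * g

theorem pd_coord (i j : Fin 3) : pd i (coord j) = if j = i then 1 else 0 := by
  rw [coord, pd_ofSmooth]
  refine Subtype.ext <| funext fun p => (_root_.pd_coord i j p).trans ?_
  split_ifs <;> rfl

theorem pd_invNorm (i : Fin 3) : pd i invNorm = -(coord i * invNorm ^ 3) := by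
  rw [invNorm, pd_ofSmooth]
  exact Subtype.ext <| funext fun p => pd_inv_norm i p.2

theorem invNorm_sq_mul :
    invNorm ^ 2 * (coord 0 ^ 2 + coord 1 ^ 2 + coord 2 ^ 2) = 1 := by
  refine Subtype.ext <| funext fun p => ?_
  have hn : ‖p.1‖ ≠ 0 := norm_ne_zero_iff.2 p.2
  have h : (‖p.1‖⁻¹) ^ 2 * (p.1 0 ^ 2 + p.1 1 ^ 2 + p.1 2 ^ 2) = 1 := by
    have := EuclideanSpace.real_norm_sq_eq p.1
    rw [Fin.sum_univ_three] at this
    rw [← this]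
    field_simp
  change ((‖p.1‖⁻¹ : ℝ) : ℂ) ^ 2 * ((p.1 0 : ℂ) ^ 2 + (p.1 1 : ℂ) ^ 2 + (p.1 2 : ℂ) ^ 2) = 1
  exact_mod_cast h

theorem schrodinger_commute (c : ℂ) (i : Fin 3) (g : puncturedSmooth) :
    schrodinger c (angular i g) = angular i (schrodinger c g) ∧
    schrodinger c (rungeLenz c i g) = rungeLenz c i (schrodinger c g) := by
  obtain ⟨h1, h2, h3⟩ : i ≠ i + 1 ∧ i ≠ i + 2 ∧ i + 1 ≠ i + 2 := by revert i; decide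
  refine derivation_schrodinger_commute (pd i) (pd (i + 1)) (pd (i + 2))
    (coord i) (coord (i + 1)) (coord (i + 2)) invNorm c Complex.I
    (pd_comm _ _) (pd_comm _ _) (pd_comm _ _)
    ?_ ?_ ?_ ?_ ?_ ?_ ?_ ?_ ?_ (pd_invNorm _) (pd_invNorm _) (pd_invNorm _) ?_ g
    _ _ (angular (i + 1)) (angular (i + 2)) _ ?_ (fun _ => rfl) ?_ ?_ (fun _ => rfl)
  iterate 9 simp [pd_coord, h1, h2, h3, h1.symm, h2.symm, h3.symm]
  · rw [← invNorm_sq_mul]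
    fin_cases i <;> simp <;> ring
  · intro g
    rw [schrodinger]
    fin_cases i <;> simp <;> ring
  · intro g
    fin_cases i <;> rfl
  · intro g
    fin_cases i <;> rfl

variable {F : E3 → ℂ} {g : puncturedSmooth}

theorem eqOn_pd (h : Set.EqOn F (extendZero g) {x | x ≠ 0}) (i : Fin 3) :
    Set.EqOn (_root_.pd i F) (extendZero (pd i g)) {x | x ≠ 0} :=
  fun _ hx => (pd_congr h i hx).trans (extendZero_apply (pd i g) hx).symm

theorem eqOn_schrodinger (γ : ℝ) (h : Set.EqOn F (extendZero g) {x | x ≠ 0}) :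
    Set.EqOn (Tsch γ F) (extendZero (schrodinger γ g)) {x | x ≠ 0} := fun x hx => by
  have hd i := eqOn_pd (eqOn_pd h i) i hx
  simp only [Tsch, hd, h hx, extendZero_apply _ hx, schrodinger]
  simp [invNorm, ofSmooth, div_eq_mul_inv]

theorem eqOn_L1 (h : Set.EqOn F (extendZero g) {x | x ≠ 0}) :
    Set.EqOn (L1 F) (extendZero (angular 0 g)) {x | x ≠ 0} := fun x hx => by
  simp only [L1, eqOn_pd h _ hx, extendZero_apply _ hx, angular]
  rfl

theorem eqOn_L2 (h : Set.EqOn F (extendZero g) {x | x ≠ 0}) :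
    Set.EqOn (L2 F) (extendZero (angular 1 g)) {x | x ≠ 0} := fun x hx => by
  simp only [L2, eqOn_pd h _ hx, extendZero_apply _ hx, angular]
  rfl

theorem eqOn_L3 (h : Set.EqOn F (extendZero g) {x | x ≠ 0}) :
    Set.EqOn (L3 F) (extendZero (angular 2 g)) {x | x ≠ 0} := fun x hx => by
  simp only [L3, eqOn_pd h _ hx, extendZero_apply _ hx, angular]
  rfl

theorem eqOn_R1 (γ : ℝ) (h : Set.EqOn F (extendZero g) {x | x ≠ 0}) :
    Set.EqOn (R1 γ F) (extendZero (rungeLenz γ 0 g)) {x | x ≠ 0} := fun x hx => by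
  simp only [R1, eqOn_L3 (eqOn_pd h 1) hx, eqOn_L2 (eqOn_pd h 2) hx, eqOn_pd h _ hx, h hx,
    extendZero_apply _ hx, rungeLenz]
  simp [invNorm, coord, ofSmooth, div_eq_mul_inv]

theorem eqOn_R2 (γ : ℝ) (h : Set.EqOn F (extendZero g) {x | x ≠ 0}) :
    Set.EqOn (R2 γ F) (extendZero (rungeLenz γ 1 g)) {x | x ≠ 0} := fun x hx => by
  simp only [R2, eqOn_L1 (eqOn_pd h 2) hx, eqOn_L3 (eqOn_pd h 0) hx, eqOn_pd h _ hx, h hx,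
    extendZero_apply _ hx, rungeLenz]
  simp [invNorm, coord, ofSmooth, div_eq_mul_inv]

theorem eqOn_R3 (γ : ℝ) (h : Set.EqOn F (extendZero g) {x | x ≠ 0}) :
    Set.EqOn (R3 γ F) (extendZero (rungeLenz γ 2 g)) {x | x ≠ 0} := fun x hx => by
  simp only [R3, eqOn_L2 (eqOn_pd h 0) hx, eqOn_L1 (eqOn_pd h 1) hx, eqOn_pd h _ hx, h hx,
    extendZero_apply _ hx, rungeLenz]
  simp [invNorm, coord, ofSmooth, div_eq_mul_inv]

end puncturedSmooth

/-- Each angular momentum operator `Lᵢ` and each Runge–Lenz operator `Rᵢ` commutes with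
the rescaled Schrödinger operator `T` on smooth functions on `ℝ³ ∖ {0}`. -/
theorem symmetries_commute_with_schrodinger
    (γ : ℝ) (hγ : 0 < γ)
    (f : E3 → ℂ) (hf : ContDiffOn ℝ (⊤ : ℕ∞) f {x : E3 | x ≠ 0})
    (x : E3) (hx : x ≠ 0) :
    Tsch γ (L1 f) x = L1 (Tsch γ f) x ∧
    Tsch γ (L2 f) x = L2 (Tsch γ f) x ∧
    Tsch γ (L3 f) x = L3 (Tsch γ f) x ∧
    Tsch γ (R1 γ f) x = R1 γ (Tsch γ f) x ∧
    Tsch γ (R2 γ f) x = R2 γ (Tsch γ f) x ∧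
    Tsch γ (R3 γ f) x = R3 γ (Tsch γ f) x := by
  have h : Set.EqOn f (extendZero (puncturedSmooth.ofSmooth f hf)) {x | x ≠ 0} :=
    (extendZero_eqOn f).symm
  have hT := puncturedSmooth.eqOn_schrodinger γ h
  have hc i := puncturedSmooth.schrodinger_commute γ i (puncturedSmooth.ofSmooth f hf)
  open puncturedSmooth in
  refine ⟨?_, ?_, ?_, ?_, ?_, ?_⟩
  · rw [eqOn_schrodinger γ (eqOn_L1 h) hx, eqOn_L1 hT hx, (hc 0).1]
  · rw [eqOn_schrodinger γ (eqOn_L2 h) hx, eqOn_L2 hT hx, (hc 1).1]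
  · rw [eqOn_schrodinger γ (eqOn_L3 h) hx, eqOn_L3 hT hx, (hc 2).1]
  · rw [eqOn_schrodinger γ (eqOn_R1 γ h) hx, eqOn_R1 γ hT hx, (hc 0).2]
  · rw [eqOn_schrodinger γ (eqOn_R2 γ h) hx, eqOn_R2 γ hT hx, (hc 1).2]
  · rw [eqOn_schrodinger γ (eqOn_R3 γ h) hx, eqOn_R3 γ hT hx, (hc 2).2]
end
end

section
/- Let γ > 0, let λ < 0 be real, and let ℓ ∈ ℕ. Then the following are equivalent: (a) there exists a twice continuously differentiable function f : (0,∞) → ℂ, not identically zero, solving the radial Schrödinger equation r²f''(r) + 2rf'(r) − ℓ(ℓ+1)f(r) + 2γrf(r) + λr²f(r) = 0 on (0,∞), bounded on (0,1), and square-integrable in the sense that ∫₀^∞ |f(r)|² r² dr < ∞; (b) there exists an integer n ≥ ℓ+1 with λ = −γ²/n². In particular, the negative values of λ admitting bound states are exactly the hydrogen energy levels −γ²/n², n = 1,2,3,…. -/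
noncomputable section

open MeasureTheory

open Filter Topology

/-- The function defined by the real power series with coefficients `c`. -/
def powerSum (c : ℕ → ℝ) (r : ℝ) : ℝ := ∑' k, c k * r ^ k

/-- The coefficients of the termwise derivative of a power series. -/
def derivCoeff (c : ℕ → ℝ) (k : ℕ) : ℝ := (k + 1) * c (k + 1)

/-- Coefficients bounded by those of `B * exp (A * r)`. -/
def ExpBounded (c : ℕ → ℝ) : Prop :=
  ∃ A B : ℝ, 0 ≤ A ∧ 0 ≤ B ∧ ∀ k, |c k| ≤ B * (A ^ k / k.factorial)

lemma ExpBounded.deriv {c : ℕ → ℝ} (hc : ExpBounded c) : ExpBounded (derivCoeff c) := by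
  obtain ⟨A, B, hA, hB, h⟩ := hc
  refine ⟨A, B * A, hA, mul_nonneg hB hA, fun k => ?_⟩
  have hk : (0 : ℝ) < k + 1 := by positivity
  rw [derivCoeff, abs_mul, abs_of_pos hk]
  refine (mul_le_mul_of_nonneg_left (h (k + 1)) hk.le).trans_eq ?_
  rw [Nat.factorial_succ]
  push_cast
  field_simp
  ring

lemma ExpBounded.summable {c : ℕ → ℝ} (hc : ExpBounded c) (r : ℝ) :
    Summable fun k => c k * r ^ k := by
  obtain ⟨A, B, hA, hB, h⟩ := hc
  refine Summable.of_norm_bounded ((Real.summable_pow_div_factorial (A * |r|)).mul_left B)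
    fun k => ?_
  rw [norm_mul, norm_pow, Real.norm_eq_abs, Real.norm_eq_abs]
  refine (mul_le_mul_of_nonneg_right (h k) (by positivity)).trans_eq ?_
  rw [mul_pow]
  ring

lemma ExpBounded.hasSum {c : ℕ → ℝ} (hc : ExpBounded c) (r : ℝ) :
    HasSum (fun k => c k * r ^ k) (powerSum c r) := (hc.summable r).hasSum

lemma ExpBounded.hasSum_index_mul {c : ℕ → ℝ} (hc : ExpBounded c) (r : ℝ) :
    HasSum (fun k : ℕ => k * c k * r ^ k) (r * powerSum (derivCoeff c) r) := by
  have h := (hc.deriv.hasSum r).mul_left r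
  rw [← hasSum_nat_add_iff' 1]
  simp only [Finset.range_one, Finset.sum_singleton, Nat.cast_zero, zero_mul, sub_zero]
  rw [show (fun k : ℕ => ((k + 1 : ℕ) : ℝ) * c (k + 1) * r ^ (k + 1)) =
    fun k => r * (derivCoeff c k * r ^ k) from funext fun k => by
      simp only [derivCoeff]
      push_cast
      ring]
  exact h

lemma ExpBounded.hasDerivAt_powerSum {c : ℕ → ℝ} (hc : ExpBounded c) (r : ℝ) :
    HasDerivAt (powerSum c) (powerSum (derivCoeff c) r) r := by
  obtain ⟨A, B, hA, hB, hAB⟩ := hc.deriv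
  set R := |r| + 1 with hR
  have hR0 : 0 < R := by positivity
  have key : HasDerivAt (fun z : ℝ => ∑' k, c k * z ^ k)
      (∑' k : ℕ, c k * (k * r ^ (k - 1))) r := by
    refine hasDerivAt_tsum_of_isPreconnected (t := Metric.ball 0 R) (y₀ := 0)
      (u := fun k : ℕ => |c k| * (k * R ^ (k - 1))) ?_ Metric.isOpen_ball
      (convex_ball (0 : ℝ) R).isPreconnected (fun k y _ => (hasDerivAt_pow k y).const_mul _)
      (fun k y hy => ?_) (by simpa using hR0) (hc.summable 0) (by simp [hR])
    · rw [← summable_nat_add_iff 1]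
      refine Summable.of_nonneg_of_le (fun k => by positivity) (fun k => ?_)
        ((Real.summable_pow_div_factorial (A * R)).mul_left B)
      have h1 := mul_le_mul_of_nonneg_right (hAB k) (pow_nonneg hR0.le k)
      have hk : (0 : ℝ) < k + 1 := by positivity
      rw [derivCoeff, abs_mul, abs_of_pos hk] at h1
      rw [mul_pow]
      push_cast [Nat.add_sub_cancel]
      calc _ = (↑k + 1) * |c (k + 1)| * R ^ k := by ring
        _ ≤ _ := h1
        _ = _ := by ring
    · rw [mem_ball_zero_iff, Real.norm_eq_abs] at hy
      rw [norm_mul, norm_mul, norm_pow, Real.norm_eq_abs, Real.norm_eq_abs, Real.norm_eq_abs,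
        Nat.abs_cast]
      gcongr
  have hs : powerSum (derivCoeff c) r = ∑' k : ℕ, c k * (k * r ^ (k - 1)) := by
    refine (HasSum.tsum_eq ?_).symm
    rw [← hasSum_nat_add_iff' 1]
    simp only [Finset.range_one, Finset.sum_singleton, Nat.cast_zero, zero_mul, mul_zero, sub_zero]
    rw [show (fun k : ℕ => c (k + 1) * (((k + 1 : ℕ) : ℝ) * r ^ (k + 1 - 1))) =
      fun k => derivCoeff c k * r ^ k from funext fun k => by
        simp only [derivCoeff, Nat.add_sub_cancel]
        push_cast
        ring]
    exact hc.deriv.hasSum r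
  rw [hs]
  exact key

/-- Taylor coefficients of the regular radial Coulomb solution, after splitting off the factor
`r ^ ℓ * exp (-κ * r)`. -/
def coulombCoeff (γ κ : ℝ) (ℓ : ℕ) : ℕ → ℝ
  | 0 => 1
  | k + 1 => 2 * (κ * (k + ℓ + 1) - γ) / ((k + 1) * (k + 2 * ℓ + 2)) * coulombCoeff γ κ ℓ k

lemma coulombCoeff_succ (γ κ : ℝ) (ℓ k : ℕ) : coulombCoeff γ κ ℓ (k + 1) =
    2 * (κ * (k + ℓ + 1) - γ) / ((k + 1) * (k + 2 * ℓ + 2)) * coulombCoeff γ κ ℓ k := rfl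

lemma expBounded_coulombCoeff {γ κ : ℝ} (hγ : 0 < γ) (hκ : 0 < κ) (ℓ : ℕ) :
    ExpBounded (coulombCoeff γ κ ℓ) := by
  refine ⟨2 * (κ + γ), 1, by positivity, zero_le_one, fun k => ?_⟩
  rw [one_mul]
  induction k with
  | zero => simp [coulombCoeff]
  | succ k ih =>
    have hq : |2 * (κ * (k + ℓ + 1) - γ) / ((k + 1) * (k + 2 * ℓ + 2))|
        ≤ 2 * (κ + γ) / (k + 1) := by
      rw [abs_div, abs_of_pos (by positivity : (0 : ℝ) < (k + 1) * (k + 2 * ℓ + 2)),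
        div_le_div_iff₀ (by positivity) (by positivity)]
      have h1 : |2 * (κ * (k + ℓ + 1) - γ)| ≤ 2 * (κ + γ) * (k + 2 * ℓ + 2) := by
        have hk : (0 : ℝ) ≤ k := k.cast_nonneg
        have hl : (0 : ℝ) ≤ ℓ := ℓ.cast_nonneg
        rw [abs_le]
        constructor <;> nlinarith [mul_nonneg hκ.le hk, mul_nonneg hκ.le hl,
          mul_nonneg hγ.le hk, mul_nonneg hγ.le hl]
      calc _ ≤ 2 * (κ + γ) * (k + 2 * ℓ + 2) * (k + 1) := by gcongr
        _ = _ := by ring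
    rw [coulombCoeff_succ, abs_mul]
    refine (mul_le_mul hq ih (abs_nonneg _) (by positivity)).trans_eq ?_
    rw [Nat.factorial_succ]
    push_cast
    field_simp
    ring

lemma coulomb_powerSum_ode {γ κ : ℝ} (hγ : 0 < γ) (hκ : 0 < κ) (ℓ : ℕ) (r : ℝ) :
    r * powerSum (derivCoeff (derivCoeff (coulombCoeff γ κ ℓ))) r
      + (2 * ℓ + 2 - 2 * κ * r) * powerSum (derivCoeff (coulombCoeff γ κ ℓ)) r
      + (2 * γ - 2 * κ * (ℓ + 1)) * powerSum (coulombCoeff γ κ ℓ) r = 0 := by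
  have hc := expBounded_coulombCoeff hγ hκ ℓ
  have h := (((hc.deriv.hasSum_index_mul r).add
    ((hc.deriv.hasSum r).mul_left (2 * ℓ + 2 : ℝ))).add
    ((hc.hasSum_index_mul r).mul_left (-(2 * κ)))).add
    ((hc.hasSum r).mul_left (2 * γ - 2 * κ * (ℓ + 1)))
  have h0 : HasSum (fun _ : ℕ => (0 : ℝ)) 0 := hasSum_zero
  have := h.unique (by
    convert h0 using 2 with k
    simp only [derivCoeff, coulombCoeff_succ]
    field_simp
    ring)
  linarith

lemma tendsto_eval_mul_exp_neg (p : Polynomial ℝ) {κ : ℝ} (hκ : 0 < κ) :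
    Tendsto (fun r => p.eval r * Real.exp (-κ * r)) atTop (𝓝 0) := by
  have h := ((p.comp (Polynomial.C κ⁻¹ * Polynomial.X)).tendsto_div_exp_atTop).comp
    (tendsto_id.const_mul_atTop hκ)
  refine h.congr fun r => ?_
  simp [Polynomial.eval_comp, inv_mul_cancel_left₀ hκ.ne', Real.exp_neg, div_eq_mul_inv]

/-- If no coefficient vanishes, the power series grows at least like `exp (κ * r)`. -/
lemma coulomb_powerSum_growth {γ κ : ℝ} (hγ : 0 < γ) (hκ : 0 < κ) (ℓ : ℕ)
    (hne : ∀ k, coulombCoeff γ κ ℓ k ≠ 0) :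
    ∃ C : ℝ, 0 < C ∧ ∀ᶠ r in atTop, C ≤ |Real.exp (-κ * r) * powerSum (coulombCoeff γ κ ℓ) r| := by
  set c := coulombCoeff γ κ ℓ with hcdef
  have hc : ExpBounded c := expBounded_coulombCoeff hγ hκ ℓ
  obtain ⟨K, hK⟩ := exists_nat_ge (2 * γ / κ)
  rw [div_le_iff₀ hκ] at hK
  obtain ⟨σ, hσ1, hσc⟩ : ∃ σ : ℝ, |σ| = 1 ∧ σ * c K = |c K| := by
    rcases abs_choice (c K) with h | h
    · exact ⟨1, abs_one, by rw [one_mul, h]⟩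
    · exact ⟨-1, by simp, by rw [neg_one_mul, h]⟩
  set C : ℝ := |c K| * K.factorial / κ ^ K with hC
  have hC0 : 0 < C := by have := abs_pos.2 (hne K); positivity
  have hlow : ∀ j, C * (κ ^ (K + j) / (K + j).factorial) ≤ σ * c (K + j) := by
    intro j
    induction j with
    | zero =>
      rw [add_zero, hσc, hC]
      apply le_of_eq
      field_simp
    | succ j ih =>
      rw [← add_assoc, hcdef, coulombCoeff_succ, ← hcdef]
      have hq : κ / ((K + j : ℕ) + 1) ≤ 2 * (κ * ((K + j : ℕ) + ℓ + 1) - γ) /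
          (((K + j : ℕ) + 1) * ((K + j : ℕ) + 2 * ℓ + 2)) := by
        rw [div_le_div_iff₀ (by positivity) (by positivity)]
        have : κ * ((K + j : ℕ) + 2 * ℓ + 2) ≤ 2 * (κ * ((K + j : ℕ) + ℓ + 1) - γ) := by
          push_cast
          nlinarith [mul_nonneg hκ.le (Nat.cast_nonneg (α := ℝ) j)]
        calc _ = κ * ((K + j : ℕ) + 2 * ℓ + 2) * ((K + j : ℕ) + 1) := by ring
          _ ≤ _ := by gcongr
      calc _ = κ / ((K + j : ℕ) + 1) * (C * (κ ^ (K + j) / (K + j).factorial)) := by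
            rw [Nat.factorial_succ, pow_succ]
            push_cast
            field_simp
        _ ≤ _ := mul_le_mul hq ih (by positivity) ((by positivity : (0 : ℝ) ≤ _).trans hq)
        _ = _ := by ring
  set d : ℕ → ℝ := fun k => σ * c k - C * (κ ^ k / k.factorial) with hd
  set p : Polynomial ℝ := ∑ k ∈ Finset.range K, Polynomial.C (d k) * Polynomial.X ^ k with hp
  have hbound : ∀ r, 0 ≤ r → p.eval r ≤ σ * powerSum c r - C * Real.exp (κ * r) := by
    intro r hr
    have hexp : HasSum (fun k : ℕ => (κ * r) ^ k / k.factorial) (Real.exp (κ * r)) := by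
      rw [Real.exp_eq_exp_ℝ]
      exact NormedSpace.expSeries_div_hasSum_exp _
    have hs := ((hc.hasSum r).mul_left σ).sub (hexp.mul_left C)
    have : p.eval r = ∑ k ∈ Finset.range K,
        (σ * (c k * r ^ k) - C * ((κ * r) ^ k / k.factorial)) := by
      simp only [hp, hd, Polynomial.eval_finsetSum, Polynomial.eval_mul, Polynomial.eval_C,
        Polynomial.eval_pow, Polynomial.eval_X]
      refine Finset.sum_congr rfl fun k _ => ?_
      rw [mul_pow]; ring
    rw [this]
    refine sum_le_hasSum _ (fun k hk => ?_) hs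
    obtain ⟨j, rfl⟩ := Nat.exists_eq_add_of_le (not_lt.1 (Finset.mem_range.not.1 hk))
    have h2 := mul_le_mul_of_nonneg_right (hlow j) (pow_nonneg hr (K + j))
    rw [mul_pow]
    rw [show C * (κ ^ (K + j) / ↑(K + j).factorial) * r ^ (K + j) =
      C * (κ ^ (K + j) * r ^ (K + j) / ↑(K + j).factorial) by ring] at h2
    linarith
  refine ⟨C / 2, by positivity, ?_⟩
  filter_upwards [(tendsto_eval_mul_exp_neg p hκ).eventually
      (lt_mem_nhds (by linarith : -(C / 2) < 0)),
    eventually_ge_atTop 0] with r hr hr0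
  have h1 := mul_le_mul_of_nonneg_right (hbound r hr0) (Real.exp_pos (-κ * r)).le
  have h2 : Real.exp (κ * r) * Real.exp (-κ * r) = 1 := by rw [← Real.exp_add]; simp
  have h3 : σ * (Real.exp (-κ * r) * powerSum c r) ≤ |Real.exp (-κ * r) * powerSum c r| := by
    refine (le_abs_self _).trans_eq ?_
    rw [abs_mul, hσ1, one_mul]
  refine le_trans ?_ h3
  have : (σ * powerSum c r - C * Real.exp (κ * r)) * Real.exp (-κ * r)
    = σ * (Real.exp (-κ * r) * powerSum c r) - C := by linear_combination -C * h2
  linarith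

/-- On `(0,∞)`, the pair `(f, p)` solves `p = r² f'`, `p' = q f`. -/
def IsRadialSolution (q : ℝ → ℝ) (f p : ℝ → ℂ) : Prop :=
  ∀ r : ℝ, 0 < r → HasDerivAt f (p r / (r : ℂ) ^ 2) r ∧ HasDerivAt p ((q r : ℂ) * f r) r

lemma IsRadialSolution.eq_zero {q : ℝ → ℝ} (hq : Continuous q) {f p : ℝ → ℂ}
    (h : IsRadialSolution q f p) {b : ℝ} (hb : 0 < b) (hfb : f b = 0) (hpb : p b = 0)
    {r : ℝ} (hr : 0 < r) : f r = 0 := by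
  set a := min r b / 2
  set d := max r b + 1
  have ha : 0 < a := half_pos (lt_min hr hb)
  have hmem : ∀ x, min r b ≤ x → x ≤ max r b → x ∈ Set.Ioo a d := fun x h1 h2 =>
    ⟨(half_lt_self (lt_min hr hb)).trans_le h1, h2.trans_lt (lt_add_one _)⟩
  obtain ⟨M, hM⟩ := isCompact_Icc.exists_bound_of_continuousOn (s := Set.Icc a d) hq.continuousOn
  set K : NNReal := ⟨max M (1 / a ^ 2), le_max_of_le_right (by positivity)⟩
  have hKM : M ≤ (K : ℝ) := le_max_left _ _
  have hKa : 1 / a ^ 2 ≤ (K : ℝ) := le_max_right _ _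
  have := ODE_solution_unique_of_mem_Ioo (a := a) (b := d) (t₀ := b) (K := K)
    (v := fun t x => ((x.2 / (t : ℂ) ^ 2, (q t : ℂ) * x.1) : ℂ × ℂ)) (s := fun _ => Set.univ)
    (f := fun t => (f t, p t)) (g := fun _ => 0) (fun t ht => ?_)
    (hmem b (min_le_right _ _) (le_max_right _ _))
    (fun t ht => ⟨(h t (ha.trans ht.1)).1.prodMk (h t (ha.trans ht.1)).2, Set.mem_univ _⟩)
    (fun t ht => ⟨(hasDerivAt_const t (0 : ℂ × ℂ)).congr_deriv (by simp [Prod.ext_iff]),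
      Set.mem_univ _⟩)
    (by simp [hfb, hpb]) (hmem r (min_le_left _ _) (le_max_left _ _))
  · exact congrArg Prod.fst this
  · refine (LipschitzWith.of_dist_le_mul fun x y => ?_).lipschitzOnWith
    have ht0 : 0 < t := ha.trans ht.1
    rw [dist_eq_norm, dist_eq_norm, Prod.norm_def]
    refine max_le ?_ ?_
    · simp only [Prod.fst_sub, ← sub_div]
      rw [norm_div, norm_pow, Complex.norm_real, Real.norm_of_nonneg ht0.le, div_eq_inv_mul,
        ← one_div]
      refine mul_le_mul ((one_div_le_one_div_of_le (by positivity) ?_).trans hKa)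
        (norm_snd_le (x - y)) (norm_nonneg _) K.coe_nonneg
      exact pow_le_pow_left₀ ha.le ht.1.le 2
    · simp only [Prod.snd_sub, ← mul_sub]
      rw [norm_mul, Complex.norm_real]
      exact mul_le_mul ((hM t ⟨ht.1.le, ht.2.le⟩).trans hKM) (norm_fst_le (x - y))
        (norm_nonneg _) K.coe_nonneg

/-- Boundedness of `f` near zero forces `r² f'` to vanish linearly there. -/
lemma IsRadialSolution.norm_momentum_le {q : ℝ → ℝ} (hq : Continuous q) {f p : ℝ → ℂ}
    (h : IsRadialSolution q f p) {M : ℝ} (hM : ∀ r : ℝ, 0 < r → r < 1 → ‖f r‖ ≤ M) :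
    ∃ D : ℝ, ∀ s : ℝ, 0 < s → s < 1 / 2 → ‖p s‖ ≤ D * s := by
  obtain ⟨Q, hQ⟩ := isCompact_Icc.exists_bound_of_continuousOn (s := Set.Icc 0 1) hq.continuousOn
  have hQ0 : 0 ≤ Q := (norm_nonneg _).trans (hQ 0 (by simp))
  have hM0 : 0 ≤ M := (norm_nonneg _).trans (hM (1 / 2) (by norm_num) (by norm_num))
  refine ⟨2 * (2 * M + Q * M), fun s hs hs1 => ?_⟩
  have hpos : ∀ x ∈ Set.Icc s (2 * s), 0 < x := fun x hx => hs.trans_le hx.1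
  have hlt : ∀ x ∈ Set.Icc s (2 * s), x < 1 := fun x hx => by linarith [hx.2]
  have hsm : s ∈ Set.Icc s (2 * s) := ⟨le_rfl, by linarith⟩
  have h2sm : 2 * s ∈ Set.Icc s (2 * s) := ⟨by linarith, le_rfl⟩
  have hp : ∀ x ∈ Set.Icc s (2 * s), ‖p x - p s‖ ≤ Q * M * s := by
    intro x hx
    have h1 := (convex_Icc s (2 * s)).norm_image_sub_le_of_norm_hasDerivWithin_le
      (fun y hy => (h y (hpos y hy)).2.hasDerivWithinAt) (C := Q * M) (fun y hy => by
        rw [norm_mul, Complex.norm_real]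
        exact mul_le_mul (hQ y ⟨(hpos y hy).le, (hlt y hy).le⟩) (hM y (hpos y hy) (hlt y hy))
          (norm_nonneg _) hQ0) hsm hx
    refine h1.trans (mul_le_mul_of_nonneg_left ?_ (by positivity))
    rw [Real.norm_of_nonneg (sub_nonneg.2 hx.1)]
    linarith [hx.2]
  have hf := (convex_Icc s (2 * s)).norm_image_sub_le_of_norm_hasDerivWithin_le
    (f := fun x : ℝ => f x + p s * ((x : ℂ))⁻¹) (f' := fun x : ℝ => (p x - p s) / (x : ℂ) ^ 2)
    (C := Q * M / s) (fun x hx => by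
      have hx0 : (x : ℂ) ≠ 0 := Complex.ofReal_ne_zero.2 (hpos x hx).ne'
      have := (h x (hpos x hx)).1.add (((hasDerivAt_id x).ofReal_comp.inv hx0).const_mul (p s))
      refine (this.congr_deriv ?_).hasDerivWithinAt
      simp only [id, Complex.ofReal_one]
      field_simp
      ring) (fun x hx => by
      rw [norm_div, norm_pow, Complex.norm_real, Real.norm_of_nonneg (hpos x hx).le]
      have : s ^ 2 ≤ x ^ 2 := pow_le_pow_left₀ hs.le hx.1 2
      calc _ ≤ Q * M * s / s ^ 2 := div_le_div₀ (by positivity) (hp x hx) (by positivity) this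
        _ = Q * M / s := by field_simp) hsm h2sm
  have hs0 : (s : ℂ) ≠ 0 := Complex.ofReal_ne_zero.2 hs.ne'
  have hC : Q * M / s * ‖2 * s - s‖ = Q * M := by
    rw [show 2 * s - s = s by ring, Real.norm_of_nonneg hs.le]
    field_simp
  rw [hC] at hf
  have he : p s = 2 * s * (f (2 * s : ℝ) - f s -
      (f (2 * s : ℝ) + p s * ((2 * s : ℝ) : ℂ)⁻¹ - (f s + p s * (s : ℂ)⁻¹))) := by
    push_cast
    field_simp
    ring
  rw [he, norm_mul, norm_mul, Complex.norm_real, Real.norm_of_nonneg hs.le, Complex.norm_ofNat]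
  have h3 := norm_sub_le (f (2 * s : ℝ) - f s)
    (f (2 * s : ℝ) + p s * ((2 * s : ℝ) : ℂ)⁻¹ - (f s + p s * (s : ℂ)⁻¹))
  have h4 := norm_sub_le (f (2 * s : ℝ)) (f s)
  have h5 := hM _ (hpos _ h2sm) (hlt _ h2sm)
  have h6 := hM _ (hpos _ hsm) (hlt _ hsm)
  calc _ ≤ 2 * s * (2 * M + Q * M) := by
        refine mul_le_mul_of_nonneg_left ?_ (by positivity)
        linarith
    _ = _ := by ring

lemma IsRadialSolution.wronskian_eq_zero {q : ℝ → ℝ} (hq : Continuous q) {f p g u : ℝ → ℂ}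
    (hf : IsRadialSolution q f p) (hg : IsRadialSolution q g u) {M N : ℝ}
    (hM : ∀ r : ℝ, 0 < r → r < 1 → ‖f r‖ ≤ M) (hN : ∀ r : ℝ, 0 < r → r < 1 → ‖g r‖ ≤ N)
    {r : ℝ} (hr : 0 < r) : f r * u r - p r * g r = 0 := by
  obtain ⟨D, hD⟩ := hf.norm_momentum_le hq hM
  obtain ⟨E, hE⟩ := hg.norm_momentum_le hq hN
  have hder : ∀ x : ℝ, 0 < x → HasDerivAt (fun x => f x * u x - p x * g x) 0 x := fun x hx => by
    refine (((hf x hx).1.mul (hg x hx).2).sub ((hf x hx).2.mul (hg x hx).1)).congr_deriv ?_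
    ring
  have hconst : ∀ x : ℝ, 0 < x → f x * u x - p x * g x = f r * u r - p r * g r := fun x hx =>
    isOpen_Ioi.is_const_of_deriv_eq_zero (s := Set.Ioi (0 : ℝ))
      (f := fun x => f x * u x - p x * g x) (convex_Ioi 0).isPreconnected
      (fun y hy => (hder y hy).differentiableAt.differentiableWithinAt)
      (fun y hy => (hder y hy).deriv) hx hr
  have hM0 : 0 ≤ M := (norm_nonneg _).trans (hM (1 / 2) (by norm_num) (by norm_num))
  have hbound : ∀ᶠ x : ℝ in 𝓝[>] 0, ‖f r * u r - p r * g r‖ ≤ (M * E + D * N) * x := by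
    filter_upwards [Ioo_mem_nhdsGT (by norm_num : (0 : ℝ) < 1 / 2)] with x hx
    have hx1 : x < 1 := hx.2.trans (by norm_num)
    rw [← hconst x hx.1]
    refine (norm_sub_le _ _).trans ?_
    rw [norm_mul, norm_mul]
    have h1 := mul_le_mul (hM x hx.1 hx1) (hE x hx.1 hx.2) (norm_nonneg _) hM0
    have h2 := mul_le_mul (hD x hx.1 hx.2) (hN x hx.1 hx1) (norm_nonneg _)
      ((norm_nonneg _).trans (hD x hx.1 hx.2))
    linarith
  have hlim : Tendsto (fun x : ℝ => (M * E + D * N) * x) (𝓝[>] 0) (𝓝 0) := by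
    have : Tendsto (fun x : ℝ => (M * E + D * N) * x) (𝓝 0) (𝓝 ((M * E + D * N) * 0)) :=
      (continuous_const.mul continuous_id).tendsto 0
    rw [mul_zero] at this
    exact this.mono_left nhdsWithin_le_nhds
  exact norm_le_zero_iff.1 (ge_of_tendsto hlim hbound)

/-- Two solutions bounded near zero are proportional. -/
lemma IsRadialSolution.exists_eq_mul {q : ℝ → ℝ} (hq : Continuous q) {f p g u : ℝ → ℂ}
    (hf : IsRadialSolution q f p) (hg : IsRadialSolution q g u) {M N : ℝ}
    (hM : ∀ r : ℝ, 0 < r → r < 1 → ‖f r‖ ≤ M) (hN : ∀ r : ℝ, 0 < r → r < 1 → ‖g r‖ ≤ N)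
    {b : ℝ} (hb : 0 < b) (hgb : g b ≠ 0) : ∃ c : ℂ, ∀ r : ℝ, 0 < r → f r = c * g r := by
  have hW := hf.wronskian_eq_zero hq hg hM hN hb
  refine ⟨f b / g b, fun r hr => sub_eq_zero.1 ?_⟩
  have hsol : IsRadialSolution q (fun x => f x - f b / g b * g x)
      (fun x => p x - f b / g b * u x) := fun x hx =>
    ⟨((hf x hx).1.sub ((hg x hx).1.const_mul _)).congr_deriv (by ring),
      ((hf x hx).2.sub ((hg x hx).2.const_mul _)).congr_deriv (by ring)⟩
  refine hsol.eq_zero hq hb ?_ ?_ hr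
  · simp [hgb]
  · field_simp
    linear_combination -hW

/-- The solution of the radial equation that is regular at the origin. -/
def regularSol (γ κ : ℝ) (ℓ : ℕ) (r : ℝ) : ℝ :=
  r ^ ℓ * Real.exp (-κ * r) * powerSum (coulombCoeff γ κ ℓ) r

/-- The derivative of `regularSol` on `(0,∞)`. -/
def regularSolDeriv (γ κ : ℝ) (ℓ : ℕ) (r : ℝ) : ℝ :=
  r ^ ℓ * Real.exp (-κ * r) * (powerSum (derivCoeff (coulombCoeff γ κ ℓ)) r
    + (ℓ / r - κ) * powerSum (coulombCoeff γ κ ℓ) r)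

/-- The second derivative of `regularSol` on `(0,∞)`. -/
def regularSolDeriv2 (γ κ : ℝ) (ℓ : ℕ) (r : ℝ) : ℝ :=
  r ^ ℓ * Real.exp (-κ * r) * (powerSum (derivCoeff (derivCoeff (coulombCoeff γ κ ℓ))) r
    + 2 * (ℓ / r - κ) * powerSum (derivCoeff (coulombCoeff γ κ ℓ)) r
    + ((ℓ / r - κ) ^ 2 - ℓ / r ^ 2) * powerSum (coulombCoeff γ κ ℓ) r)

lemma hasDerivAt_pow_mul_exp (κ : ℝ) (ℓ : ℕ) {r : ℝ} (hr : 0 < r) :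
    HasDerivAt (fun r : ℝ => r ^ ℓ * Real.exp (-κ * r))
      (r ^ ℓ * Real.exp (-κ * r) * (ℓ / r - κ)) r := by
  refine ((hasDerivAt_pow ℓ r).mul ((hasDerivAt_id r).const_mul (-κ)).exp).congr_deriv ?_
  have : (ℓ : ℝ) * r ^ (ℓ - 1) = r ^ ℓ * (ℓ / r) := by
    rcases ℓ with _ | m
    · simp
    · rw [Nat.add_sub_cancel, pow_succ]
      field_simp
  rw [this]
  simp only [id]
  ring

lemma hasDerivAt_regularSol {γ κ : ℝ} (hγ : 0 < γ) (hκ : 0 < κ) (ℓ : ℕ) {r : ℝ} (hr : 0 < r) :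
    HasDerivAt (regularSol γ κ ℓ) (regularSolDeriv γ κ ℓ r) r := by
  refine ((hasDerivAt_pow_mul_exp κ ℓ hr).mul
    ((expBounded_coulombCoeff hγ hκ ℓ).hasDerivAt_powerSum r)).congr_deriv ?_
  rw [regularSolDeriv]
  ring

lemma hasDerivAt_regularSolDeriv {γ κ : ℝ} (hγ : 0 < γ) (hκ : 0 < κ) (ℓ : ℕ) {r : ℝ}
    (hr : 0 < r) : HasDerivAt (regularSolDeriv γ κ ℓ) (regularSolDeriv2 γ κ ℓ r) r := by
  have hc := expBounded_coulombCoeff hγ hκ ℓ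
  have hdiv : HasDerivAt (fun r : ℝ => (ℓ : ℝ) / r - κ) (-(ℓ / r ^ 2)) r := by
    refine (((hasDerivAt_inv hr.ne').const_mul (ℓ : ℝ)).sub_const κ).congr_deriv ?_
    ring
  refine ((hasDerivAt_pow_mul_exp κ ℓ hr).mul ((hc.deriv.hasDerivAt_powerSum r).add
    (hdiv.mul (hc.hasDerivAt_powerSum r)))).congr_deriv ?_
  simp only [regularSolDeriv2, Pi.add_apply, Pi.mul_apply]
  ring

lemma regularSol_ode {γ κ : ℝ} (hγ : 0 < γ) (hκ : 0 < κ) (ℓ : ℕ) {r : ℝ} (hr : 0 < r) :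
    r ^ 2 * regularSolDeriv2 γ κ ℓ r + 2 * r * regularSolDeriv γ κ ℓ r
      - (ℓ * (ℓ + 1)) * regularSol γ κ ℓ r + 2 * γ * r * regularSol γ κ ℓ r
      - κ ^ 2 * r ^ 2 * regularSol γ κ ℓ r = 0 := by
  have h := coulomb_powerSum_ode hγ hκ ℓ r
  simp only [regularSolDeriv2, regularSolDeriv, regularSol]
  generalize Real.exp (-κ * r) = e
  field_simp
  linear_combination r ^ ℓ * e * r * h

lemma continuous_regularSol {γ κ : ℝ} (hγ : 0 < γ) (hκ : 0 < κ) (ℓ : ℕ) :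
    Continuous (regularSol γ κ ℓ) := by
  have : Continuous (powerSum (coulombCoeff γ κ ℓ)) := continuous_iff_continuousAt.2 fun r =>
    ((expBounded_coulombCoeff hγ hκ ℓ).hasDerivAt_powerSum r).continuousAt
  unfold regularSol
  fun_prop

lemma exists_regularSol_bound {γ κ : ℝ} (hγ : 0 < γ) (hκ : 0 < κ) (ℓ : ℕ) :
    ∃ M : ℝ, ∀ r : ℝ, 0 < r → r < 1 → ‖(regularSol γ κ ℓ r : ℂ)‖ ≤ M := by
  obtain ⟨M, hM⟩ := isCompact_Icc.exists_bound_of_continuousOn (s := Set.Icc 0 1)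
    (continuous_regularSol hγ hκ ℓ).continuousOn
  exact ⟨M, fun r h0 h1 => by rw [Complex.norm_real]; exact hM r ⟨h0.le, h1.le⟩⟩

lemma exists_regularSol_ne_zero {γ κ : ℝ} (hγ : 0 < γ) (hκ : 0 < κ) (ℓ : ℕ) :
    ∃ r : ℝ, 0 < r ∧ regularSol γ κ ℓ r ≠ 0 := by
  have h0 : powerSum (coulombCoeff γ κ ℓ) 0 = 1 := by
    rw [powerSum, tsum_eq_single 0 (fun k hk => by simp [hk])]
    simp [coulombCoeff]
  have hev := ((expBounded_coulombCoeff hγ hκ ℓ).hasDerivAt_powerSum 0).continuousAt.eventually_ne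
    (by rw [h0]; exact one_ne_zero)
  obtain ⟨r, hr, hr0⟩ := ((hev.filter_mono nhdsWithin_le_nhds).and
    (self_mem_nhdsWithin : Set.Ioi (0 : ℝ) ∈ 𝓝[>] 0)).exists
  exact ⟨r, hr0, mul_ne_zero (mul_ne_zero (pow_ne_zero _ (ne_of_gt hr0)) (Real.exp_ne_zero _)) hr⟩

lemma isRadialSolution_of_ode {γ lam : ℝ} {ℓ : ℕ} {f f' f'' : ℝ → ℂ}
    (hf : ∀ r : ℝ, 0 < r → HasDerivAt f (f' r) r)
    (hf' : ∀ r : ℝ, 0 < r → HasDerivAt f' (f'' r) r)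
    (hode : ∀ r : ℝ, 0 < r → (r : ℂ) ^ 2 * f'' r + 2 * (r : ℂ) * f' r
      - ((ℓ * (ℓ + 1) : ℕ) : ℂ) * f r + 2 * (γ : ℂ) * (r : ℂ) * f r
      + (lam : ℂ) * (r : ℂ) ^ 2 * f r = 0) :
    IsRadialSolution (fun r => ℓ * (ℓ + 1) - 2 * γ * r - lam * r ^ 2) f
      (fun r => (r : ℂ) ^ 2 * f' r) := by
  intro r hr
  have hr0 : (r : ℂ) ≠ 0 := Complex.ofReal_ne_zero.2 hr.ne'
  refine ⟨(hf r hr).congr_deriv (by field_simp), ?_⟩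
  refine (((hasDerivAt_id r).ofReal_comp.pow 2).mul (hf' r hr)).congr_deriv ?_
  have h := hode r hr
  push_cast at h ⊢
  simp only [id, Pi.pow_apply]
  linear_combination h

lemma regularSol_ode_complex {γ κ lam : ℝ} (hγ : 0 < γ) (hκ : 0 < κ) (hlam : lam = -κ ^ 2)
    (ℓ : ℕ) (r : ℝ) (hr : 0 < r) : (r : ℂ) ^ 2 * (regularSolDeriv2 γ κ ℓ r : ℂ)
      + 2 * (r : ℂ) * (regularSolDeriv γ κ ℓ r : ℂ)
      - ((ℓ * (ℓ + 1) : ℕ) : ℂ) * (regularSol γ κ ℓ r : ℂ)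
      + 2 * (γ : ℂ) * (r : ℂ) * (regularSol γ κ ℓ r : ℂ)
      + (lam : ℂ) * (r : ℂ) ^ 2 * (regularSol γ κ ℓ r : ℂ) = 0 := by
  have h := congrArg (fun x : ℝ => (x : ℂ)) (regularSol_ode hγ hκ ℓ hr)
  rw [hlam]
  push_cast at h ⊢
  linear_combination h

lemma continuousOn_regularSolDeriv2 {γ κ : ℝ} (hγ : 0 < γ) (hκ : 0 < κ) (ℓ : ℕ) :
    ContinuousOn (regularSolDeriv2 γ κ ℓ) (Set.Ioi 0) := by
  have hc := expBounded_coulombCoeff hγ hκ ℓ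
  have hcont : ∀ {c : ℕ → ℝ}, ExpBounded c → Continuous (powerSum c) := fun hc =>
    continuous_iff_continuousAt.2 fun r => (hc.hasDerivAt_powerSum r).continuousAt
  have h0 := hcont hc
  have h1 := hcont hc.deriv
  have h2 := hcont hc.deriv.deriv
  have hdiv : ContinuousOn (fun r : ℝ => (ℓ : ℝ) / r) (Set.Ioi 0) :=
    continuousOn_const.div continuousOn_id fun r hr => ne_of_gt hr
  have hdiv2 : ContinuousOn (fun r : ℝ => (ℓ : ℝ) / r ^ 2) (Set.Ioi 0) :=
    continuousOn_const.div (continuousOn_id.pow 2) fun r hr => pow_ne_zero 2 (ne_of_gt hr)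
  unfold regularSolDeriv2
  fun_prop

/-- If the coefficients terminate, the regular solution is square-integrable. -/
lemma integrableOn_regularSol_sq {γ κ : ℝ} (hγ : 0 < γ) (hκ : 0 < κ) (ℓ N : ℕ)
    (hN : ∀ k, N ≤ k → coulombCoeff γ κ ℓ k = 0) :
    IntegrableOn (fun r : ℝ => ‖(regularSol γ κ ℓ r : ℂ)‖ ^ 2 * r ^ 2) (Set.Ioi 0) := by
  have hcont := continuous_regularSol hγ hκ ℓ
  set P : Polynomial ℝ :=
    ∑ k ∈ Finset.range N, Polynomial.C (coulombCoeff γ κ ℓ k) * Polynomial.X ^ k with hP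
  have hev : ∀ r, powerSum (coulombCoeff γ κ ℓ) r = P.eval r := fun r => by
    rw [powerSum, tsum_eq_sum (s := Finset.range N) (fun k hk => by
      rw [hN k (not_lt.1 (Finset.mem_range.not.1 hk)), zero_mul])]
    simp [hP, Polynomial.eval_finsetSum]
  refine integrable_of_isBigO_exp_neg hκ
    (by simp only [Complex.norm_real]; fun_prop) ?_
  refine Asymptotics.IsLittleO.isBigO ?_
  refine (Asymptotics.isLittleO_iff_tendsto fun r hr => absurd hr (Real.exp_ne_zero _)).2 ?_
  refine (tendsto_eval_mul_exp_neg (Polynomial.X ^ (2 * ℓ + 2) * P ^ 2) hκ).congr fun r => ?_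
  rw [eq_div_iff (Real.exp_ne_zero _), Complex.norm_real, Real.norm_eq_abs, sq_abs, regularSol,
    hev]
  simp only [Polynomial.eval_mul, Polynomial.eval_pow, Polynomial.eval_X]
  ring

/-- If no coefficient vanishes, nonzero multiples of the regular solution are not
square-integrable. -/
lemma not_integrableOn_regularSol_sq {γ κ : ℝ} (hγ : 0 < γ) (hκ : 0 < κ) (ℓ : ℕ)
    (hne : ∀ k, coulombCoeff γ κ ℓ k ≠ 0) {f : ℝ → ℂ} {c : ℂ} (hc : c ≠ 0)
    (hf : ∀ r : ℝ, 0 < r → f r = c * (regularSol γ κ ℓ r : ℂ)) :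
    ¬ IntegrableOn (fun r : ℝ => ‖f r‖ ^ 2 * r ^ 2) (Set.Ioi 0) := by
  intro hint
  obtain ⟨C, hC, hev⟩ := coulomb_powerSum_growth hγ hκ ℓ hne
  obtain ⟨R, hR⟩ := eventually_atTop.1 (hev.and (eventually_ge_atTop 1))
  have hR1 : 1 ≤ R := (hR R le_rfl).2
  have hc0 : 0 < ‖c‖ := norm_pos_iff.2 hc
  have hlow : ∀ r ∈ Set.Ioi R, ‖(‖c‖ * C) ^ 2‖ ≤ ‖f r‖ ^ 2 * r ^ 2 := by
    intro r hr
    obtain ⟨h1, h2⟩ := hR r (le_of_lt hr)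
    have hr0 : 0 < r := by linarith
    rw [Real.norm_of_nonneg (by positivity), ← mul_pow]
    refine pow_le_pow_left₀ (by positivity) ?_ 2
    rw [hf r hr0, norm_mul, Complex.norm_real, regularSol, mul_assoc (r ^ ℓ), norm_mul, norm_pow,
      Real.norm_of_nonneg hr0.le, mul_assoc, Real.norm_eq_abs]
    refine mul_le_mul_of_nonneg_left ?_ hc0.le
    calc C ≤ |Real.exp (-κ * r) * powerSum (coulombCoeff γ κ ℓ) r| := h1
      _ ≤ r ^ (ℓ + 1) * |Real.exp (-κ * r) * powerSum (coulombCoeff γ κ ℓ) r| :=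
        le_mul_of_one_le_left (abs_nonneg _) (one_le_pow₀ h2)
      _ = _ := by ring
  have hconst : IntegrableOn (fun _ : ℝ => (‖c‖ * C) ^ 2) (Set.Ioi R) :=
    Integrable.mono' (hint.mono_set (Set.Ioi_subset_Ioi (by linarith)))
      aestronglyMeasurable_const ((ae_restrict_iff' measurableSet_Ioi).2 (.of_forall hlow))
  rw [integrableOn_const_iff] at hconst
  rcases hconst with h | h
  · exact (by positivity : (‖c‖ * C) ^ 2 ≠ 0) (by simpa using h)
  · simp at h

/-- For `λ < 0`, the radial Schrödinger equation admits a nonzero solution on `(0,∞)` that is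
bounded near zero and square-integrable (w.r.t. `r² dr`) if and only if `λ = −γ²/n²` for some
integer `n ≥ ℓ+1`: the hydrogen bound-state energy levels. -/
theorem bound_states_iff_hydrogen_levels (γ : ℝ) (hγ : 0 < γ) (lam : ℝ) (hlam : lam < 0)
    (ℓ : ℕ) :
    (∃ f f' f'' : ℝ → ℂ,
      (∀ r : ℝ, 0 < r → HasDerivAt f (f' r) r) ∧
      (∀ r : ℝ, 0 < r → HasDerivAt f' (f'' r) r) ∧
      ContinuousOn f'' (Set.Ioi 0) ∧
      (∃ r : ℝ, 0 < r ∧ f r ≠ 0) ∧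
      (∀ r : ℝ, 0 < r → (r : ℂ) ^ 2 * f'' r + 2 * (r : ℂ) * f' r
          - ((ℓ * (ℓ + 1) : ℕ) : ℂ) * f r + 2 * (γ : ℂ) * (r : ℂ) * f r
          + (lam : ℂ) * (r : ℂ) ^ 2 * f r = 0) ∧
      (∃ M : ℝ, ∀ r : ℝ, 0 < r → r < 1 → ‖f r‖ ≤ M) ∧
      IntegrableOn (fun r : ℝ => ‖f r‖ ^ 2 * r ^ 2) (Set.Ioi 0)) ↔
    (∃ n : ℕ, ℓ + 1 ≤ n ∧ lam = -γ ^ 2 / (n : ℝ) ^ 2) := by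
  constructor
  · rintro ⟨f, f', f'', hf, hf', -, ⟨r₀, hr₀, hfr₀⟩, hode, ⟨M, hM⟩, hint⟩
    by_contra hno
    set κ := √(-lam) with hκdef
    have hκ : 0 < κ := Real.sqrt_pos.2 (by linarith)
    have hκ2 : lam = -κ ^ 2 := by rw [hκdef, Real.sq_sqrt (by linarith)]; ring
    have hne : ∀ k, coulombCoeff γ κ ℓ k ≠ 0 := by
      intro k
      induction k with
      | zero => exact one_ne_zero
      | succ k ih =>
        rw [coulombCoeff_succ]
        refine mul_ne_zero (div_ne_zero (mul_ne_zero two_ne_zero fun h => hno ?_)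
          (by positivity)) ih
        refine ⟨k + ℓ + 1, by omega, ?_⟩
        rw [hκ2, ← sub_eq_zero.1 h]
        push_cast
        field_simp
    obtain ⟨N, hN⟩ := exists_regularSol_bound hγ hκ ℓ
    obtain ⟨b, hb, hgb⟩ := exists_regularSol_ne_zero hγ hκ ℓ
    have hg := isRadialSolution_of_ode
      (fun r hr => (hasDerivAt_regularSol hγ hκ ℓ hr).ofReal_comp)
      (fun r hr => (hasDerivAt_regularSolDeriv hγ hκ ℓ hr).ofReal_comp)
      (regularSol_ode_complex hγ hκ hκ2 ℓ)
    obtain ⟨c, hc⟩ := (isRadialSolution_of_ode hf hf' hode).exists_eq_mul (by fun_prop) hg hM hN hb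
      (Complex.ofReal_ne_zero.2 hgb)
    refine not_integrableOn_regularSol_sq hγ hκ ℓ hne (c := c) ?_ hc hint
    rintro rfl
    exact hfr₀ (by rw [hc r₀ hr₀, zero_mul])
  · rintro ⟨n, hn, hlamn⟩
    have hn0 : (0 : ℝ) < n := by exact_mod_cast (by omega : 0 < n)
    have hκ : 0 < γ / n := by positivity
    have hκ2 : lam = -(γ / n) ^ 2 := by rw [hlamn]; ring
    have hzero : ∀ k, n - ℓ ≤ k → coulombCoeff γ (γ / n) ℓ k = 0 := by
      intro k hk
      induction k, hk using Nat.le_induction with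
      | base =>
        obtain ⟨m, rfl⟩ := Nat.exists_eq_add_of_le hn
        rw [show ℓ + 1 + m - ℓ = m + 1 by omega, coulombCoeff_succ]
        have : γ / ((ℓ + 1 + m : ℕ) : ℝ) * (m + ℓ + 1) - γ = 0 := by
          push_cast
          field_simp
          ring
        rw [this]
        simp
      | succ k _ ih => rw [coulombCoeff_succ, ih, mul_zero]
    obtain ⟨r, hr, hr0⟩ := exists_regularSol_ne_zero hγ hκ ℓ
    exact ⟨fun r => (regularSol γ (γ / n) ℓ r : ℂ), fun r => (regularSolDeriv γ (γ / n) ℓ r : ℂ),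
      fun r => (regularSolDeriv2 γ (γ / n) ℓ r : ℂ),
      fun r hr => (hasDerivAt_regularSol hγ hκ ℓ hr).ofReal_comp,
      fun r hr => (hasDerivAt_regularSolDeriv hγ hκ ℓ hr).ofReal_comp,
      Complex.continuous_ofReal.comp_continuousOn (continuousOn_regularSolDeriv2 hγ hκ ℓ),
      ⟨r, hr, Complex.ofReal_ne_zero.2 hr0⟩, regularSol_ode_complex hγ hκ hκ2 ℓ,
      exists_regularSol_bound hγ hκ ℓ, integrableOn_regularSol_sq hγ hκ ℓ (n - ℓ) hzero⟩
end
end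

section
/- Let γ > 0 and let k ∈ ℂ with Im(k) ≥ 0 and k ≠ 0. Then there exists a unique smooth function u : (0,∞) → ℂ such that −u''(r) − (2/r)u'(r) − (2γ/r)u(r) = k²u(r) for all r > 0, and u(r)·r·exp(−i·k·r − i·(γ/k)·log r) → 1 as r → ∞. -/
noncomputable section

/-- `u : (0,∞) → ℂ` is a Kodaira solution for parameter `k`: a smooth solution of the
`ℓ = 0` radial Schrödinger equation `−u'' − (2/r)u' − (2γ/r)u = k²u` on `(0,∞)` with
`u(r)·r·exp(−ikr − i(γ/k)log r) → 1` as `r → ∞`. -/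
def IsKodaira (γ : ℝ) (k : ℂ) (u : ℝ → ℂ) : Prop :=
  ContDiffOn ℝ (⊤ : ℕ∞) u (Set.Ioi 0) ∧
  (∀ r : ℝ, 0 < r →
    -(deriv (deriv u) r) - ((2 / r : ℝ) : ℂ) * deriv u r - ((2 * γ / r : ℝ) : ℂ) * u r
      = k ^ 2 * u r) ∧
  Filter.Tendsto
    (fun r : ℝ => u r * (r : ℂ) *
      Complex.exp (-(Complex.I * k * (r : ℂ)) - Complex.I * ((γ : ℂ) / k) * (Real.log r : ℂ)))
    Filter.atTop (nhds 1)

open Set Filter Topology MeasureTheory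

/-- The tail integral of a continuous function is an antiderivative of its negative. -/
theorem hasDerivAt_integral_Ioi {E : Type*} [NormedAddCommGroup E] [NormedSpace ℝ E]
    [CompleteSpace E] {g : ℝ → E} (hg : ContinuousOn g (Ioi 0))
    (hi : ∀ r, 0 < r → IntegrableOn g (Ioi r)) {r : ℝ} (hr : 0 < r) :
    HasDerivAt (fun x => ∫ s in Ioi x, g s) (-g r) r := by
  have hr2 : 0 < r / 2 := by positivity
  have h1 : HasDerivAt (fun x => ∫ s in (r / 2)..x, g s) (g r) r := by
    refine intervalIntegral.integral_hasDerivAt_right ?_ ?_ (hg.continuousAt (Ioi_mem_nhds hr))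
    · refine (hg.mono ?_).intervalIntegrable
      rw [uIcc_of_le (by linarith)]
      exact fun x hx => lt_of_lt_of_le hr2 hx.1
    · exact hg.stronglyMeasurableAtFilter isOpen_Ioi r hr
  refine (h1.const_sub (∫ s in Ioi (r / 2), g s)).congr_of_eventuallyEq ?_
  filter_upwards [Ioi_mem_nhds (show r / 2 < r by linarith)] with x hx
  rw [← intervalIntegral.integral_Ioi_sub_Ioi (hi _ hr2) (le_of_lt hx)]
  abel

theorem tendsto_integral_Ioi_atTop {g : ℝ → ℝ} (hi : ∀ r, 0 < r → IntegrableOn g (Ioi r)) :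
    Tendsto (fun x => ∫ s in Ioi x, g s) atTop (𝓝 0) := by
  have h := intervalIntegral_tendsto_integral_Ioi 1 (hi 1 one_pos) tendsto_id
  have h2 := h.const_sub (∫ s in Ioi 1, g s)
  rw [sub_self] at h2
  refine h2.congr' ?_
  filter_upwards [eventually_ge_atTop 1] with x hx
  rw [id, ← intervalIntegral.integral_Ioi_sub_Ioi (hi 1 one_pos) hx]
  abel

/-- The Bielecki weight attached to the integrable density `M`. -/
def bieleckiWeight (M : ℝ → ℝ) (r : ℝ) : ℝ := Real.exp (2 * ∫ s in Ioi r, M s)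

section Weight

variable {M : ℝ → ℝ}

theorem bieleckiWeight_pos (M : ℝ → ℝ) (r : ℝ) : 0 < bieleckiWeight M r := Real.exp_pos _

theorem hasDerivAt_bieleckiWeight (hM : ContinuousOn M (Ioi 0))
    (hi : ∀ r, 0 < r → IntegrableOn M (Ioi r)) {r : ℝ} (hr : 0 < r) :
    HasDerivAt (bieleckiWeight M) (-2 * (M r * bieleckiWeight M r)) r := by
  have h := ((hasDerivAt_integral_Ioi hM hi hr).const_mul 2).exp
  refine h.congr_deriv ?_
  unfold bieleckiWeight
  ring

theorem tendsto_bieleckiWeight (hi : ∀ r, 0 < r → IntegrableOn M (Ioi r)) :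
    Tendsto (bieleckiWeight M) atTop (𝓝 1) := by
  have h := (Real.continuous_exp.tendsto _).comp ((tendsto_integral_Ioi_atTop hi).const_mul 2)
  simp only [mul_zero, Real.exp_zero] at h
  exact h

theorem continuousOn_bieleckiWeight (hM : ContinuousOn M (Ioi 0))
    (hi : ∀ r, 0 < r → IntegrableOn M (Ioi r)) : ContinuousOn (bieleckiWeight M) (Ioi 0) :=
  fun _ hr => (hasDerivAt_bieleckiWeight hM hi hr).continuousAt.continuousWithinAt

theorem integral_mul_bieleckiWeight (hM : ContinuousOn M (Ioi 0)) (hM0 : ∀ r, 0 < r → 0 ≤ M r)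
    (hi : ∀ r, 0 < r → IntegrableOn M (Ioi r)) {r : ℝ} (hr : 0 < r) :
    IntegrableOn (fun s => M s * bieleckiWeight M s) (Ioi r) ∧
      ∫ s in Ioi r, M s * bieleckiWeight M s = (bieleckiWeight M r - 1) / 2 := by
  have hd : ∀ x ∈ Ici r, HasDerivAt (fun x => (-1 / 2) * bieleckiWeight M x)
      (M x * bieleckiWeight M x) x := fun x hx => by
    refine ((hasDerivAt_bieleckiWeight hM hi (lt_of_lt_of_le hr hx)).const_mul (-1 / 2)).congr_deriv
      ?_
    ring
  have hpos : ∀ x ∈ Ioi r, 0 ≤ M x * bieleckiWeight M x := fun x hx =>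
    mul_nonneg (hM0 x (hr.trans hx)) (bieleckiWeight_pos M x).le
  have ht : Tendsto (fun x => (-1 / 2) * bieleckiWeight M x) atTop (𝓝 ((-1 / 2) * 1)) :=
    (tendsto_bieleckiWeight hi).const_mul _
  refine ⟨integrableOn_Ioi_deriv_of_nonneg' hd hpos ht, ?_⟩
  rw [integral_Ioi_of_hasDerivAt_of_nonneg' hd hpos ht]
  ring

/-- A function dominated by `M` times the Bielecki weight and an antitone factor has a tail
integral dominated by the same quantities. -/
theorem integrableOn_and_norm_integral_Ioi_le (hM : ContinuousOn M (Ioi 0))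
    (hM0 : ∀ r, 0 < r → 0 ≤ M r) (hi : ∀ r, 0 < r → IntegrableOn M (Ioi r))
    {e : ℝ → ℝ} (hanti : AntitoneOn e (Ioi 0)) {C : ℝ}
    (hC : 0 ≤ C) {g : ℝ → ℂ} (hg : ContinuousOn g (Ioi 0))
    (hb : ∀ s, 0 < s → ‖g s‖ ≤ C * (M s * bieleckiWeight M s) * e s) {r : ℝ} (hr : 0 < r) :
    IntegrableOn g (Ioi r) ∧
      ‖∫ s in Ioi r, g s‖ ≤ C * e r * ((bieleckiWeight M r - 1) / 2) := by
  obtain ⟨h1, h2⟩ := integral_mul_bieleckiWeight hM hM0 hi hr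
  have hbd : ∀ s ∈ Ioi r, ‖g s‖ ≤ (C * e r) * (M s * bieleckiWeight M s) := fun s hs => by
    have hs0 : 0 < s := hr.trans hs
    have hle : e s ≤ e r := hanti hr hs0 (le_of_lt hs)
    have hnn : 0 ≤ C * (M s * bieleckiWeight M s) :=
      mul_nonneg hC (mul_nonneg (hM0 s hs0) (bieleckiWeight_pos M s).le)
    calc ‖g s‖ ≤ C * (M s * bieleckiWeight M s) * e s := hb s hs0
      _ ≤ C * (M s * bieleckiWeight M s) * e r := mul_le_mul_of_nonneg_left hle hnn
      _ = _ := by ring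
  have hae : ∀ᵐ s ∂(volume.restrict (Ioi r)), ‖g s‖ ≤ (C * e r) * (M s * bieleckiWeight M s) :=
    (ae_restrict_iff' measurableSet_Ioi).2 (Eventually.of_forall hbd)
  have hMint := h1.const_mul (C * e r)
  refine ⟨hMint.mono' ((hg.mono fun s hs => hr.trans hs).aestronglyMeasurable measurableSet_Ioi) hae,
    ?_⟩
  calc ‖∫ s in Ioi r, g s‖ ≤ ∫ s in Ioi r, (C * e r) * (M s * bieleckiWeight M s) :=
        norm_integral_le_of_norm_le hMint hae
    _ = _ := by rw [integral_const_mul, h2]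

end Weight

open scoped BoundedContinuousFunction

section Volterra

variable {M e : ℝ → ℝ} {a b : ℝ → ℂ}

/-- One row of a linear system, applied to the pair of functions obtained from `z` by the
substitution `x = log s` and multiplication with the weights. -/
def weightedRow (M e : ℝ → ℝ) (a b : ℝ → ℂ) (z : ℝ →ᵇ ℂ × ℂ) (s : ℝ) : ℂ :=
  a s * ((bieleckiWeight M s : ℂ) * (z (Real.log s)).1) +
    b s * ((e s : ℂ) * (bieleckiWeight M s : ℂ) * (z (Real.log s)).2)

theorem weightedRow_sub (z z' : ℝ →ᵇ ℂ × ℂ) (s : ℝ) :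
    weightedRow M e a b (z - z') s = weightedRow M e a b z s - weightedRow M e a b z' s := by
  simp only [weightedRow, BoundedContinuousFunction.coe_sub, Pi.sub_apply, Prod.fst_sub,
    Prod.snd_sub]
  ring

theorem continuousOn_weightedRow (hM : ContinuousOn M (Ioi 0))
    (hi : ∀ r, 0 < r → IntegrableOn M (Ioi r)) (he : ContinuousOn e (Ioi 0))
    (ha : ContinuousOn a (Ioi 0)) (hb : ContinuousOn b (Ioi 0)) (z : ℝ →ᵇ ℂ × ℂ) :
    ContinuousOn (weightedRow M e a b z) (Ioi 0) := by
  have hw : ContinuousOn (fun s => (bieleckiWeight M s : ℂ)) (Ioi 0) :=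
    Complex.continuous_ofReal.comp_continuousOn (continuousOn_bieleckiWeight hM hi)
  have he' : ContinuousOn (fun s => (e s : ℂ)) (Ioi 0) :=
    Complex.continuous_ofReal.comp_continuousOn he
  have hz : ContinuousOn (fun s => z (Real.log s)) (Ioi 0) :=
    z.continuous.comp_continuousOn
      (Real.continuousOn_log.mono fun s hs => (ne_of_gt (show (0 : ℝ) < s from hs)))
  exact (ha.mul (hw.mul hz.fst)).add (hb.mul ((he'.mul hw).mul hz.snd))

theorem norm_weightedRow_le {ε : ℝ → ℝ} (hpos : ∀ s, 0 < s → 0 < e s)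
    (hab : ∀ s, 0 < s → ‖a s‖ + ‖b s‖ * e s ≤ M s * ε s) (z : ℝ →ᵇ ℂ × ℂ) {s : ℝ} (hs : 0 < s) :
    ‖weightedRow M e a b z s‖ ≤ ‖z‖ * (M s * bieleckiWeight M s) * ε s := by
  have hz := z.norm_coe_le_norm (Real.log s)
  have h1 : ‖(z (Real.log s)).1‖ ≤ ‖z‖ := (norm_fst_le _).trans hz
  have h2 : ‖(z (Real.log s)).2‖ ≤ ‖z‖ := (norm_snd_le _).trans hz
  have hw := bieleckiWeight_pos M s
  have he := hpos s hs
  calc ‖weightedRow M e a b z s‖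
      ≤ ‖a s‖ * (bieleckiWeight M s * ‖(z (Real.log s)).1‖) +
        ‖b s‖ * (e s * bieleckiWeight M s * ‖(z (Real.log s)).2‖) := by
        refine (norm_add_le _ _).trans (le_of_eq ?_)
        simp only [norm_mul, Complex.norm_real, Real.norm_eq_abs, abs_of_pos hw, abs_of_pos he]
    _ ≤ ‖a s‖ * (bieleckiWeight M s * ‖z‖) + ‖b s‖ * (e s * bieleckiWeight M s * ‖z‖) := by
        gcongr
    _ = (bieleckiWeight M s * ‖z‖) * (‖a s‖ + ‖b s‖ * e s) := by ring
    _ ≤ (bieleckiWeight M s * ‖z‖) * (M s * ε s) :=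
        mul_le_mul_of_nonneg_left (hab s hs) (mul_nonneg hw.le (norm_nonneg _))
    _ = _ := by ring

/-- A linear system of two equations whose coefficients are integrable at infinity, up to an
antitone rescaling `e` of the second unknown, has a solution asymptotic to `(1, 0)`. -/
theorem exists_solution_asymptotic {c d : ℝ → ℂ}
    (hM : ContinuousOn M (Ioi 0)) (hi : ∀ r, 0 < r → IntegrableOn M (Ioi r))
    (he : ContinuousOn e (Ioi 0)) (hpos : ∀ s, 0 < s → 0 < e s) (hanti : AntitoneOn e (Ioi 0))
    (ha : ContinuousOn a (Ioi 0)) (hb : ContinuousOn b (Ioi 0))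
    (hc : ContinuousOn c (Ioi 0)) (hd : ContinuousOn d (Ioi 0))
    (hab : ∀ s, 0 < s → ‖a s‖ + ‖b s‖ * e s ≤ M s)
    (hcd : ∀ s, 0 < s → ‖c s‖ + ‖d s‖ * e s ≤ M s * e s) :
    ∃ p q : ℝ → ℂ,
      (∀ r, 0 < r → HasDerivAt p (a r * p r + b r * q r) r) ∧
      (∀ r, 0 < r → HasDerivAt q (c r * p r + d r * q r) r) ∧
      Tendsto p atTop (𝓝 1) ∧ Tendsto (fun r => q r / e r) atTop (𝓝 0) := by
  set w := bieleckiWeight M with hw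
  have hw0 : ∀ r, 0 < w r := bieleckiWeight_pos M
  have hab' : ∀ s, 0 < s → ‖a s‖ + ‖b s‖ * e s ≤ M s * (fun _ => (1 : ℝ)) s := by simpa using hab
  have hM0 : ∀ s, 0 < s → 0 ≤ M s := fun s hs =>
    le_trans (by have := hpos s hs; positivity) (hab s hs)
  have g1c := continuousOn_weightedRow hM hi he ha hb
  have g2c := continuousOn_weightedRow hM hi he hc hd
  have t1 := fun (z : ℝ →ᵇ ℂ × ℂ) (r : ℝ) (hr : 0 < r) =>
    integrableOn_and_norm_integral_Ioi_le hM hM0 hi (e := fun _ => 1) (fun _ _ _ _ _ => le_rfl)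
      (norm_nonneg z) (g1c z) (fun s hs => norm_weightedRow_le hpos hab' z hs) hr
  have t2 := fun (z : ℝ →ᵇ ℂ × ℂ) (r : ℝ) (hr : 0 < r) =>
    integrableOn_and_norm_integral_Ioi_le hM hM0 hi hanti
      (norm_nonneg z) (g2c z) (fun s hs => norm_weightedRow_le hpos hcd z hs) hr
  have d1 := fun (z : ℝ →ᵇ ℂ × ℂ) (r : ℝ) (hr : 0 < r) =>
    hasDerivAt_integral_Ioi (g1c z) (fun r hr => (t1 z r hr).1) hr
  have d2 := fun (z : ℝ →ᵇ ℂ × ℂ) (r : ℝ) (hr : 0 < r) =>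
    hasDerivAt_integral_Ioi (g2c z) (fun r hr => (t2 z r hr).1) hr
  set J1 : (ℝ →ᵇ ℂ × ℂ) → ℝ → ℂ := fun z r => ∫ s in Ioi r, weightedRow M e a b z s with hJ1
  set J2 : (ℝ →ᵇ ℂ × ℂ) → ℝ → ℂ := fun z r => ∫ s in Ioi r, weightedRow M e c d z s with hJ2
  have b1 : ∀ z r, 0 < r → ‖J1 z r‖ ≤ ‖z‖ * ((w r - 1) / 2) := fun z r hr => by
    simpa using (t1 z r hr).2
  have b2 : ∀ z r, 0 < r → ‖J2 z r‖ ≤ ‖z‖ * e r * ((w r - 1) / 2) := fun z r hr => (t2 z r hr).2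
  have s1 : ∀ z z' r, 0 < r → J1 (z - z') r = J1 z r - J1 z' r := fun z z' r hr => by
    simp only [hJ1, weightedRow_sub]
    exact integral_sub (t1 z r hr).1 (t1 z' r hr).1
  have s2 : ∀ z z' r, 0 < r → J2 (z - z') r = J2 z r - J2 z' r := fun z z' r hr => by
    simp only [hJ2, weightedRow_sub]
    exact integral_sub (t2 z r hr).1 (t2 z' r hr).1
  have n1 : ∀ z r, 0 < r → ‖J1 z r / w r‖ ≤ 1 / 2 * ‖z‖ := fun z r hr => by
    rw [norm_div, Complex.norm_real, Real.norm_eq_abs, abs_of_pos (hw0 r), div_le_iff₀ (hw0 r)]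
    nlinarith [b1 z r hr, norm_nonneg z]
  have n2 : ∀ z r, 0 < r → ‖J2 z r / (e r * w r)‖ ≤ 1 / 2 * ‖z‖ := fun z r hr => by
    rw [norm_div, norm_mul, Complex.norm_real, Complex.norm_real, Real.norm_eq_abs,
      Real.norm_eq_abs, abs_of_pos (hw0 r), abs_of_pos (hpos r hr),
      div_le_iff₀ (mul_pos (hpos r hr) (hw0 r))]
    nlinarith [b2 z r hr, mul_nonneg (norm_nonneg z) (hpos r hr).le]
  have w1 : ∀ r, 0 < r → 1 ≤ w r := fun r hr => by
    have := setIntegral_nonneg (μ := volume) measurableSet_Ioi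
      (fun s (hs : s ∈ Ioi r) => hM0 s (hr.trans hs))
    exact Real.one_le_exp (by positivity)
  have cexp : ∀ {f : ℝ → ℂ}, ContinuousOn f (Ioi 0) → Continuous fun x => f (Real.exp x) :=
    fun hf => hf.comp_continuous Real.continuous_exp Real.exp_pos
  have cw : ContinuousOn (fun r => (w r : ℂ)) (Ioi 0) :=
    Complex.continuous_ofReal.comp_continuousOn (continuousOn_bieleckiWeight hM hi)
  have ce : ContinuousOn (fun r => (e r : ℂ)) (Ioi 0) :=
    Complex.continuous_ofReal.comp_continuousOn he
  have hwne : ∀ r, (w r : ℂ) ≠ 0 := fun r => by exact_mod_cast (hw0 r).ne'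
  have hene : ∀ r, 0 < r → (e r : ℂ) ≠ 0 := fun r hr => by exact_mod_cast (hpos r hr).ne'
  have cJ1 : ∀ z, ContinuousOn (J1 z) (Ioi 0) := fun z r hr =>
    (d1 z r hr).continuousAt.continuousWithinAt
  have cJ2 : ∀ z, ContinuousOn (J2 z) (Ioi 0) := fun z r hr =>
    (d2 z r hr).continuousAt.continuousWithinAt
  let T : (ℝ →ᵇ ℂ × ℂ) → (ℝ →ᵇ ℂ × ℂ) := fun z =>
    BoundedContinuousFunction.ofNormedAddCommGroup
      (fun x => (1 / (w (Real.exp x) : ℂ) - J1 z (Real.exp x) / w (Real.exp x),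
        -(J2 z (Real.exp x) / (e (Real.exp x) * w (Real.exp x)))))
      (((cexp (continuousOn_const.div cw fun r _ => hwne r)).sub
        (cexp ((cJ1 z).div cw fun r _ => hwne r))).prodMk
        (cexp ((cJ2 z).div (ce.mul cw) fun r hr => mul_ne_zero (hene r hr) (hwne r))).neg)
      (1 + 1 / 2 * ‖z‖) (fun x => by
        have hx := Real.exp_pos x
        refine norm_prod_le_iff.2 ⟨(norm_sub_le _ _).trans (add_le_add ?_ (n1 z _ hx)), ?_⟩
        · rw [norm_div, norm_one, Complex.norm_real, Real.norm_eq_abs, abs_of_pos (hw0 _)]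
          exact (div_le_one (hw0 _)).2 (w1 _ hx)
        · rw [norm_neg]
          linarith [n2 z _ hx])
  have hT : ContractingWith (1 / 2) T := by
    refine ⟨by norm_num, LipschitzWith.of_dist_le_mul fun z z' => ?_⟩
    rw [dist_eq_norm z z']
    refine (BoundedContinuousFunction.dist_le (by positivity)).2 fun x => ?_
    have hx := Real.exp_pos x
    rw [dist_eq_norm]
    refine norm_prod_le_iff.2 ⟨?_, ?_⟩
    · have h := n1 (z - z') _ hx
      rw [s1 z z' _ hx, sub_div, ← norm_neg] at h
      have heq : (T z x - T z' x).1 = (1 / (w (Real.exp x) : ℂ) - J1 z (Real.exp x) / w (Real.exp x)) -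
          (1 / (w (Real.exp x) : ℂ) - J1 z' (Real.exp x) / w (Real.exp x)) := rfl
      rw [heq]
      refine le_trans (le_of_eq ?_) (h.trans (le_of_eq (by push_cast; ring)))
      congr 1
      ring
    · have h := n2 (z - z') _ hx
      rw [s2 z z' _ hx, sub_div, ← norm_neg] at h
      have heq : (T z x - T z' x).2 = -(J2 z (Real.exp x) / (e (Real.exp x) * w (Real.exp x))) -
          -(J2 z' (Real.exp x) / (e (Real.exp x) * w (Real.exp x))) := rfl
      rw [heq]
      refine le_trans (le_of_eq ?_) (h.trans (le_of_eq (by push_cast; ring)))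
      congr 1
      ring
  obtain ⟨z, hz⟩ : ∃ z, T z = z := ⟨_, hT.fixedPoint_isFixedPt⟩
  have hz1 : ∀ r, 0 < r → w r * (z (Real.log r)).1 = 1 - J1 z r := fun r hr => by
    have h : (T z (Real.log r)).1 = 1 / (w (Real.exp (Real.log r)) : ℂ)
      - J1 z (Real.exp (Real.log r)) / w (Real.exp (Real.log r)) := rfl
    rw [hz, Real.exp_log hr] at h
    rw [h, mul_sub, mul_div_cancel₀ _ (hwne r), mul_div_cancel₀ _ (hwne r)]
  have hz2 : ∀ r, 0 < r → e r * w r * (z (Real.log r)).2 = - J2 z r := fun r hr => by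
    have h : (T z (Real.log r)).2 =
      -(J2 z (Real.exp (Real.log r)) / (e (Real.exp (Real.log r)) * w (Real.exp (Real.log r)))) :=
      rfl
    rw [hz, Real.exp_log hr] at h
    rw [h, mul_neg, mul_div_cancel₀ _ (mul_ne_zero (hene r hr) (hwne r))]
  have hlim : Tendsto (fun r => ‖z‖ * ((w r - 1) / 2)) atTop (𝓝 0) := by
    simpa using ((tendsto_bieleckiWeight hi).sub_const 1).div_const 2 |>.const_mul ‖z‖
  refine ⟨fun r => 1 - J1 z r, fun r => -J2 z r, fun r hr => ?_, fun r hr => ?_, ?_, ?_⟩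
  · refine ((d1 z r hr).const_sub 1).congr_deriv ?_
    simp only [← hz1 r hr, ← hz2 r hr]
    rw [neg_neg]
    rfl
  · refine (d2 z r hr).neg.congr_deriv ?_
    simp only [← hz1 r hr, ← hz2 r hr]
    rw [neg_neg]
    rfl
  · have h : Tendsto (J1 z) atTop (𝓝 0) := by
      refine squeeze_zero_norm' ?_ hlim
      filter_upwards [eventually_gt_atTop 0] with r hr using b1 z r hr
    simpa using h.const_sub 1
  · refine squeeze_zero_norm' ?_ hlim
    filter_upwards [eventually_gt_atTop 0] with r hr
    rw [norm_div, norm_neg, Complex.norm_real, Real.norm_eq_abs, abs_of_pos (hpos r hr),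
      div_le_iff₀ (hpos r hr)]
    linarith [b2 z r hr]

end Volterra

/-- The leading asymptotic behaviour at infinity of the outgoing Coulomb wave. -/
def coulombPhase (γ : ℝ) (k : ℂ) (r : ℝ) : ℂ :=
  Complex.exp (Complex.I * k * (r : ℂ) + Complex.I * ((γ : ℂ) / k) * (Real.log r : ℂ))

/-- `(f, g)` is a solution, with its derivative, of the one-dimensional Coulomb equation
`f'' = -(k² + 2γ/r) f` on `(0, ∞)`. -/
def IsCoulombPair (γ : ℝ) (k : ℂ) (f g : ℝ → ℂ) : Prop :=
  ∀ r : ℝ, 0 < r → HasDerivAt f (g r) r ∧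
    HasDerivAt g (-(k ^ 2 + 2 * (γ : ℂ) / (r : ℂ)) * f r) r

section Phase

variable {γ : ℝ} {k : ℂ}

theorem coulombPhase_ne_zero (γ : ℝ) (k : ℂ) (r : ℝ) : coulombPhase γ k r ≠ 0 :=
  Complex.exp_ne_zero _

theorem hasDerivAt_coulombPhase {r : ℝ} (hr : 0 < r) :
    HasDerivAt (coulombPhase γ k)
      (coulombPhase γ k r * (Complex.I * (k + (γ : ℂ) / k * (r : ℂ)⁻¹))) r := by
  have h1 : HasDerivAt (fun x : ℝ => (x : ℂ)) 1 r := Complex.ofRealCLM.hasDerivAt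
  have h2 : HasDerivAt (fun x : ℝ => (Real.log x : ℂ)) ((r⁻¹ : ℝ) : ℂ) r :=
    (Real.hasDerivAt_log hr.ne').ofReal_comp
  refine ((h1.const_mul (Complex.I * k)).add
    (h2.const_mul (Complex.I * ((γ : ℂ) / k)))).cexp.congr_deriv ?_
  rw [coulombPhase]
  push_cast
  simp only [Pi.add_apply]
  ring

theorem norm_coulombPhase (γ : ℝ) (k : ℂ) (r : ℝ) :
    ‖coulombPhase γ k r‖ = Real.exp (k.im * (γ / Complex.normSq k * Real.log r - r)) := by
  rw [coulombPhase, Complex.norm_exp]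
  congr 1
  simp [Complex.div_im]
  ring

theorem mul_log_sub_le {ρ r s : ℝ} (hr : 0 < r) (hs : 0 < s) (h : 0 ≤ (s - r) * (r - ρ))
    (hρ : 0 ≤ ρ) : ρ * Real.log s - s ≤ ρ * Real.log r - r := by
  have h1 := Real.log_le_sub_one_of_pos (div_pos hs hr)
  rw [Real.log_div hs.ne' hr.ne'] at h1
  have h2 : ρ * (s / r - 1) ≤ s - r := by
    rw [div_sub_one hr.ne', mul_div_assoc', div_le_iff₀ hr]
    nlinarith
  nlinarith [mul_le_mul_of_nonneg_left h1 hρ]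

theorem norm_coulombPhase_le (hγ : 0 < γ) (hk : 0 ≤ k.im) {r s : ℝ} (hr : 0 < r) (hs : 0 < s)
    (h : 0 ≤ (s - r) * (r - γ / Complex.normSq k)) :
    ‖coulombPhase γ k s‖ ≤ ‖coulombPhase γ k r‖ := by
  rw [norm_coulombPhase, norm_coulombPhase, Real.exp_le_exp]
  exact mul_le_mul_of_nonneg_left
    (mul_log_sub_le hr hs h (div_nonneg hγ.le (Complex.normSq_nonneg k))) hk

theorem continuousOn_coulombPhase : ContinuousOn (coulombPhase γ k) (Ioi 0) :=
  fun _ hr => (hasDerivAt_coulombPhase hr).continuousAt.continuousWithinAt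

/-- The reduced first-order system for the amplitude of the Coulomb wave. -/
theorem isCoulombPair_of_system (hk : k ≠ 0) {α c β : ℂ} (hα : α = (γ : ℂ) / k)
    (hc : c = α ^ 2 + Complex.I * α) (hβ : β = α ^ 2 / k ^ 2 - Complex.I * α / (2 * k ^ 2))
    {θ p q : ℝ → ℂ}
    (hθ : θ = fun r : ℝ => -Complex.I / (2 * k) * (1 - α / k * (r : ℂ)⁻¹))
    (hp : ∀ r : ℝ, 0 < r → HasDerivAt p (θ r * c * ((r : ℂ)⁻¹) ^ 2 * p r +
      (β - θ r ^ 2 * c) * ((r : ℂ)⁻¹) ^ 2 * (coulombPhase γ k r ^ 2)⁻¹ * q r) r)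
    (hq : ∀ r : ℝ, 0 < r → HasDerivAt q (c * coulombPhase γ k r ^ 2 * ((r : ℂ)⁻¹) ^ 2 * p r +
      (-(c * θ r * ((r : ℂ)⁻¹) ^ 2)) * q r) r) :
    IsCoulombPair γ k (fun r => coulombPhase γ k r * p r - θ r * q r / coulombPhase γ k r)
      (fun r => q r / coulombPhase γ k r + Complex.I * (k + α * (r : ℂ)⁻¹) *
        (coulombPhase γ k r * p r - θ r * q r / coulombPhase γ k r)) := by
  intro r hr
  have hr' : (r : ℂ) ≠ 0 := by exact_mod_cast hr.ne'
  have hF := coulombPhase_ne_zero γ k r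
  have hinv : HasDerivAt (fun x : ℝ => (x : ℂ)⁻¹) (-((r : ℂ)⁻¹) ^ 2) r := by
    have h1 : HasDerivAt (fun x : ℝ => (x : ℂ)) 1 r := Complex.ofRealCLM.hasDerivAt
    refine (h1.inv hr').congr_deriv ?_
    field_simp
  have hdθ : HasDerivAt θ (-Complex.I / (2 * k) * (α / k * ((r : ℂ)⁻¹) ^ 2)) r := by
    rw [hθ]
    refine (((hinv.const_mul (α / k)).const_sub 1).const_mul (-Complex.I / (2 * k))).congr_deriv ?_
    ring
  have hdF : HasDerivAt (coulombPhase γ k)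
      (coulombPhase γ k r * (Complex.I * (k + α * (r : ℂ)⁻¹))) r := hα ▸ hasDerivAt_coulombPhase hr
  have hf : HasDerivAt (fun r => coulombPhase γ k r * p r - θ r * q r / coulombPhase γ k r)
      (q r / coulombPhase γ k r + Complex.I * (k + α * (r : ℂ)⁻¹) *
        (coulombPhase γ k r * p r - θ r * q r / coulombPhase γ k r)) r := by
    refine ((hdF.mul (hp r hr)).sub ((hdθ.mul (hq r hr)).div hdF hF)).congr_deriv ?_
    have hθr : θ r = -Complex.I / (2 * k) * (1 - α / k * (r : ℂ)⁻¹) := by rw [hθ]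
    simp only [Pi.mul_apply]
    generalize coulombPhase γ k r = F at *
    generalize p r = P
    generalize q r = Q
    rw [hθr, hβ]
    field_simp
    ring_nf
    simp only [Complex.I_sq]
    ring
  refine ⟨hf, ?_⟩
  refine (((hq r hr).div hdF hF).add
    (((hinv.const_mul α).const_add k).const_mul Complex.I |>.mul hf)).congr_deriv ?_
  have hαk : (γ : ℂ) = α * k := by rw [hα]; field_simp
  simp only [hαk, hc]
  generalize coulombPhase γ k r = F at *
  generalize p r = P
  generalize q r = Q
  generalize θ r = t
  field_simp
  ring_nf
  simp only [Complex.I_sq]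
  ring

end Phase

section Existence

variable {γ : ℝ} {k : ℂ}

theorem tendsto_ofReal_inv_atTop : Tendsto (fun r : ℝ => (r : ℂ)⁻¹) atTop (𝓝 0) := by
  have h := (Complex.continuous_ofReal.tendsto 0).comp tendsto_inv_atTop_zero
  simpa [Function.comp_def] using h

theorem integrableOn_Ioi_of_eventuallyEq_mul_inv_sq {M K : ℝ → ℝ} {l : ℝ}
    (hM : ContinuousOn M (Ioi 0)) (hK : Tendsto K atTop (𝓝 l))
    (h : ∀ᶠ r in atTop, M r = K r * r⁻¹ ^ 2) {r : ℝ} (hr : 0 < r) : IntegrableOn M (Ioi r) := by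
  have hloc : LocallyIntegrableOn M (Ici r) :=
    (hM.mono fun s hs => lt_of_lt_of_le hr hs).locallyIntegrableOn measurableSet_Ici
  refine (hloc.integrableOn_of_isBigO_atTop (g := fun s : ℝ => s ^ (-2 : ℝ)) ?_
    ⟨Ioi 1, Ioi_mem_atTop 1, integrableOn_Ioi_rpow_of_lt (by norm_num) one_pos⟩).mono_set
    Ioi_subset_Ici_self
  have hO := (hK.isBigO_one ℝ).mul (Asymptotics.isBigO_refl (fun s : ℝ => s⁻¹ ^ 2) atTop)
  refine hO.congr' ?_ ?_
  · filter_upwards [h] with s hs using hs.symm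
  · filter_upwards [eventually_gt_atTop 0] with s hs
    rw [one_mul, Real.rpow_neg hs.le, Real.rpow_two, inv_pow]

theorem exists_isCoulombPair (hγ : 0 < γ) (hk1 : 0 ≤ k.im) (hk2 : k ≠ 0) :
    ∃ f g : ℝ → ℂ, IsCoulombPair γ k f g ∧
      Tendsto (fun r => f r / coulombPhase γ k r) atTop (𝓝 1) ∧
      Tendsto (fun r => g r / coulombPhase γ k r) atTop (𝓝 (Complex.I * k)) := by
  set F := coulombPhase γ k with hF
  set ρ : ℝ := γ / Complex.normSq k with hρ
  have hρ0 : 0 < ρ := div_pos hγ (Complex.normSq_pos.2 hk2)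
  set e : ℝ → ℝ := fun r => ‖F (max r ρ)‖ ^ 2 with he
  have hF0 : ∀ r, F r ≠ 0 := coulombPhase_ne_zero γ k
  have he0 : ∀ r, 0 < e r := fun r => by have := norm_pos_iff.2 (hF0 (max r ρ)); positivity
  have hmax : ∀ r, 0 < max r ρ := fun r => lt_of_lt_of_le hρ0 (le_max_right _ _)
  have hec : Continuous e :=
    ((continuousOn_coulombPhase.comp_continuous (continuous_id.max continuous_const)
      hmax).norm).pow 2
  have heanti : AntitoneOn e (Ioi 0) := fun r _ s _ hrs => by
    refine pow_le_pow_left₀ (norm_nonneg _) (norm_coulombPhase_le hγ hk1 (hmax r) (hmax s) ?_) 2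
    exact mul_nonneg (sub_nonneg.2 (max_le_max_right ρ hrs)) (sub_nonneg.2 (le_max_right _ _))
  have heF : ∀ r, ρ ≤ r → e r = ‖F r‖ ^ 2 := fun r hr => by rw [he]; simp only [max_eq_left hr]
  set α : ℂ := (γ : ℂ) / k with hα
  set c : ℂ := α ^ 2 + Complex.I * α with hc
  set β : ℂ := α ^ 2 / k ^ 2 - Complex.I * α / (2 * k ^ 2) with hβ
  set θ : ℝ → ℂ := fun r => -Complex.I / (2 * k) * (1 - α / k * (r : ℂ)⁻¹) with hθ
  have hinvc : ContinuousOn (fun r : ℝ => (r : ℂ)⁻¹) (Ioi 0) :=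
    Complex.continuous_ofReal.continuousOn.inv₀ fun r hr => by
      exact_mod_cast (show (0 : ℝ) < r from hr).ne'
  have hθc : ContinuousOn θ (Ioi 0) :=
    continuousOn_const.mul (continuousOn_const.sub (continuousOn_const.mul hinvc))
  have hFc : ContinuousOn F (Ioi 0) := continuousOn_coulombPhase
  set A : ℝ → ℂ := fun r => θ r * c * ((r : ℂ)⁻¹) ^ 2 with hA
  set B : ℝ → ℂ := fun r => (β - θ r ^ 2 * c) * ((r : ℂ)⁻¹) ^ 2 * (F r ^ 2)⁻¹ with hB
  set C : ℝ → ℂ := fun r => c * F r ^ 2 * ((r : ℂ)⁻¹) ^ 2 with hC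
  set D : ℝ → ℂ := fun r => -(c * θ r * ((r : ℂ)⁻¹) ^ 2) with hD
  have hAc : ContinuousOn A (Ioi 0) := (hθc.mul continuousOn_const).mul (hinvc.pow 2)
  have hBc : ContinuousOn B (Ioi 0) :=
    ((continuousOn_const.sub ((hθc.pow 2).mul continuousOn_const)).mul (hinvc.pow 2)).mul
      ((hFc.pow 2).inv₀ fun r _ => pow_ne_zero 2 (hF0 r))
  have hCc : ContinuousOn C (Ioi 0) := (continuousOn_const.mul (hFc.pow 2)).mul (hinvc.pow 2)
  have hDc : ContinuousOn D (Ioi 0) := ((continuousOn_const.mul hθc).mul (hinvc.pow 2)).neg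
  set M : ℝ → ℝ := fun r => ‖A r‖ + ‖B r‖ * e r + (‖C r‖ / e r + ‖D r‖) with hM
  have hMc : ContinuousOn M (Ioi 0) :=
    (hAc.norm.add (hBc.norm.mul hec.continuousOn)).add
      ((hCc.norm.div hec.continuousOn fun r _ => (he0 r).ne').add hDc.norm)
  have hθlim : Tendsto θ atTop (𝓝 (-Complex.I / (2 * k))) := by
    have h := ((tendsto_ofReal_inv_atTop.const_mul (α / k)).const_sub 1).const_mul
      (-Complex.I / (2 * k))
    simpa using h
  have hMi : ∀ r, 0 < r → IntegrableOn M (Ioi r) := fun r hr => by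
    refine integrableOn_Ioi_of_eventuallyEq_mul_inv_sq
      (K := fun r => ‖θ r * c‖ + ‖β - θ r ^ 2 * c‖ + (‖c‖ + ‖c * θ r‖)) hMc
      (((hθlim.mul_const c).norm.add ((hθlim.pow 2).mul_const c |>.const_sub β).norm).add
        (tendsto_const_nhds.add (hθlim.const_mul c).norm)) ?_ hr
    filter_upwards [eventually_ge_atTop ρ] with s hs
    have hs0 : 0 < s := lt_of_lt_of_le hρ0 hs
    have hFs : ‖F s‖ ≠ 0 := norm_ne_zero_iff.2 (hF0 s)
    simp only [hM, hA, hB, hC, hD, heF s hs, norm_mul, norm_neg, norm_pow, norm_inv,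
      Complex.norm_real, Real.norm_eq_abs, abs_of_pos hs0]
    field_simp
  obtain ⟨p, q, hp, hq, hp1, hq0⟩ := exists_solution_asymptotic hMc hMi hec.continuousOn
    (fun s _ => he0 s) heanti hAc hBc hCc hDc
    (fun s _ => by
      have := he0 s
      exact le_add_of_nonneg_right (by positivity))
    (fun s _ => by
      have h := he0 s
      calc ‖C s‖ + ‖D s‖ * e s = (‖C s‖ / e s + ‖D s‖) * e s := by field_simp
        _ ≤ M s * e s :=
          mul_le_mul_of_nonneg_right (le_add_of_nonneg_left (by positivity)) h.le)
  have hn : Tendsto (fun r => q r / F r ^ 2) atTop (𝓝 0) := by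
    refine squeeze_zero_norm' ?_ (tendsto_zero_iff_norm_tendsto_zero.1 hq0)
    filter_upwards [eventually_ge_atTop ρ] with s hs
    rw [norm_div, norm_div, Complex.norm_real, Real.norm_eq_abs, abs_of_pos (he0 s), heF s hs,
      norm_pow]
  have hm : Tendsto (fun r => p r - θ r * (q r / F r ^ 2)) atTop (𝓝 1) := by
    simpa using hp1.sub (hθlim.mul hn)
  refine ⟨_, _, isCoulombPair_of_system hk2 hα hc hβ hθ hp hq, hm.congr fun r => ?_, ?_⟩
  · have : coulombPhase γ k r ≠ 0 := hF0 r
    simp only [hF]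
    field_simp
  · have h := hn.add ((((tendsto_ofReal_inv_atTop.const_mul α).const_add k).const_mul
      Complex.I).mul hm)
    simp only [mul_zero, add_zero, mul_one, zero_add] at h
    refine h.congr fun r => ?_
    have : coulombPhase γ k r ≠ 0 := hF0 r
    simp only [hF]
    field_simp

end Existence

section Uniqueness

variable {γ : ℝ} {k : ℂ} {f g f₁ g₁ : ℝ → ℂ}

theorem IsCoulombPair.sub (h : IsCoulombPair γ k f g) (h₁ : IsCoulombPair γ k f₁ g₁) :
    IsCoulombPair γ k (fun r => f r - f₁ r) (fun r => g r - g₁ r) := fun r hr =>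
  ⟨(h r hr).1.sub (h₁ r hr).1, ((h r hr).2.sub (h₁ r hr).2).congr_deriv (by ring)⟩

theorem IsCoulombPair.const_mul (h : IsCoulombPair γ k f g) (a : ℂ) :
    IsCoulombPair γ k (fun r => a * f r) (fun r => a * g r) := fun r hr =>
  ⟨(h r hr).1.const_mul a, ((h r hr).2.const_mul a).congr_deriv (by ring)⟩

theorem IsCoulombPair.eq_zero_of_initial (h : IsCoulombPair γ k f g) {R : ℝ} (hR : 0 < R)
    (hf : f R = 0) (hg : g R = 0) {r : ℝ} (hr : 0 < r) : f r = 0 := by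
  set m := min r R / 2 with hm
  have hm0 : 0 < m := by have := lt_min hr hR; positivity
  set b := max r R + 1 with hb
  have hmr : m < r := by have := min_le_left r R; have := lt_min hr hR; linarith
  have hmR : m < R := by have := min_le_right r R; have := lt_min hr hR; linarith
  have hbr : r < b := by have := le_max_left r R; linarith
  have hbR : R < b := by have := le_max_right r R; linarith
  set K : ℝ := 1 + (‖k‖ ^ 2 + 2 * |γ| / m) with hK
  have hK0 : 0 ≤ K := by positivity
  set v : ℝ → ℂ × ℂ → ℂ × ℂ := fun t y => (y.2, -(k ^ 2 + 2 * (γ : ℂ) / (t : ℂ)) * y.1) with hv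
  have hlip : ∀ t ∈ Ioo m b, LipschitzOnWith K.toNNReal (v t) univ := fun t ht => by
    refine (LipschitzWith.of_dist_le_mul fun y y' => ?_).lipschitzOnWith
    rw [Real.coe_toNNReal K hK0, dist_eq_norm, dist_eq_norm]
    have ht0 : 0 < t := hm0.trans ht.1
    have h1 := norm_fst_le (y - y')
    have h2 := norm_snd_le (y - y')
    have hV : ‖-(k ^ 2 + 2 * (γ : ℂ) / (t : ℂ))‖ ≤ K := by
      rw [norm_neg]
      refine (norm_add_le _ _).trans ?_
      rw [norm_pow, norm_div, norm_mul, Complex.norm_real, Complex.norm_real, Real.norm_eq_abs,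
        Real.norm_eq_abs, abs_of_pos ht0, Complex.norm_ofNat]
      have : 2 * |γ| / t ≤ 2 * |γ| / m :=
        div_le_div_of_nonneg_left (by positivity) hm0 ht.1.le
      linarith
    refine norm_prod_le_iff.2 ⟨?_, ?_⟩
    · calc ‖(v t y - v t y').1‖ = ‖(y - y').2‖ := rfl
        _ ≤ 1 * ‖y - y'‖ := by rw [one_mul]; exact h2
        _ ≤ K * ‖y - y'‖ := by
          refine mul_le_mul_of_nonneg_right ?_ (norm_nonneg _)
          have : 0 ≤ ‖k‖ ^ 2 + 2 * |γ| / m := by positivity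
          linarith
    · have heq : (v t y - v t y').2 = -(k ^ 2 + 2 * (γ : ℂ) / (t : ℂ)) * (y - y').1 := by
        simp only [hv, Prod.snd_sub, Prod.fst_sub]
        ring
      rw [heq, norm_mul]
      exact mul_le_mul hV h1 (norm_nonneg _) hK0
  have := ODE_solution_unique_of_mem_Ioo (f := fun t => (f t, g t)) (g := fun _ => (0, 0))
    (v := v) (s := fun _ => univ) hlip ⟨hmR, hbR⟩
    (fun t ht => ⟨(h t (hm0.trans ht.1)).1.prodMk (h t (hm0.trans ht.1)).2, mem_univ _⟩)
    (fun t _ => ⟨(hasDerivAt_const t ((0, 0) : ℂ × ℂ)).congr_deriv (by ext <;> simp [hv]), mem_univ _⟩)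
    (by simp [hf, hg])
  exact congrArg Prod.fst (this ⟨hmr, hbr⟩)

theorem IsCoulombPair.exists_wronskian (h : IsCoulombPair γ k f g)
    (h₁ : IsCoulombPair γ k f₁ g₁) : ∃ W, ∀ r, 0 < r → g r * f₁ r - f r * g₁ r = W := by
  have hd : ∀ r, 0 < r → HasDerivAt (fun r => g r * f₁ r - f r * g₁ r) 0 r := fun r hr => by
    refine (((h r hr).2.mul (h₁ r hr).1).sub ((h r hr).1.mul (h₁ r hr).2)).congr_deriv ?_
    ring
  obtain ⟨W, hW⟩ := isOpen_Ioi.exists_is_const_of_deriv_eq_zero (isPreconnected_Ioi (a := (0 : ℝ)))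
    (fun r hr => (hd r hr).differentiableAt.differentiableWithinAt) fun r hr => (hd r hr).deriv
  exact ⟨W, hW⟩

/-- The limit of the derivative of a function converging at infinity vanishes. -/
theorem eq_zero_of_tendsto_of_tendsto_deriv {φ φ' : ℝ → ℂ} {l W : ℂ}
    (hd : ∀ r, 0 < r → HasDerivAt φ (φ' r) r) (hφ : Tendsto φ atTop (𝓝 l))
    (hφ' : Tendsto φ' atTop (𝓝 W)) : W = 0 := by
  have hshift : Tendsto (fun r : ℝ => φ (r + 1) - φ r) atTop (𝓝 0) := by
    simpa using (hφ.comp (tendsto_atTop_add_const_right atTop 1 tendsto_id)).sub hφ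
  refine tendsto_nhds_unique ?_ hshift
  rw [Metric.tendsto_atTop]
  intro ε hε
  obtain ⟨R, hR⟩ := Metric.tendsto_atTop.1 hφ' (ε / 2) (by positivity)
  refine ⟨max R 1, fun r hr => ?_⟩
  have hr0 : 0 < r := lt_of_lt_of_le one_pos ((le_max_right _ _).trans hr)
  have hb := Convex.norm_image_sub_le_of_norm_hasDerivWithin_le (𝕜 := ℝ) (s := Icc r (r + 1))
    (f := fun x => φ x - x • W) (f' := fun x => φ' x - (1 : ℝ) • W) (C := ε / 2) (x := r)
    (y := r + 1)
    (fun x hx => ((hd x (hr0.trans_le hx.1)).sub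
      ((hasDerivAt_id x).smul_const W)).hasDerivWithinAt)
    (fun x hx => by
      have h := hR x (((le_max_left _ _).trans hr).trans hx.1)
      rw [dist_eq_norm] at h
      simpa using h.le)
    (convex_Icc _ _) (by simp) (by simp)
  rw [dist_eq_norm]
  have heq : φ (r + 1) - (r + 1) • W - (φ r - r • W) = φ (r + 1) - φ r - W := by
    rw [add_smul, one_smul]
    abel
  simp only [heq] at hb
  have h1 : ‖r + 1 - r‖ = 1 := by simp
  rw [h1, mul_one] at hb
  linarith

theorem IsCoulombPair.eq_zero_of_tendsto (hγ : 0 < γ) (hk1 : 0 ≤ k.im) (hk2 : k ≠ 0)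
    (h : IsCoulombPair γ k f g) (hf : Tendsto (fun r => f r / coulombPhase γ k r) atTop (𝓝 0))
    {r : ℝ} (hr : 0 < r) : f r = 0 := by
  obtain ⟨f₁, g₁, h₁, hf₁, hg₁⟩ := exists_isCoulombPair hγ hk1 hk2
  set F := coulombPhase γ k with hF
  have hF0 : ∀ r, F r ≠ 0 := coulombPhase_ne_zero γ k
  obtain ⟨W, hW⟩ := h.exists_wronskian h₁
  have hρ0 : 0 < γ / Complex.normSq k := div_pos hγ (Complex.normSq_pos.2 hk2)
  have hbdd : IsBoundedUnder (· ≤ ·) atTop (fun r => ‖F r ^ 2‖) := by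
    refine isBoundedUnder_of_eventually_le (a := ‖F (γ / Complex.normSq k)‖ ^ 2) ?_
    filter_upwards [eventually_ge_atTop (γ / Complex.normSq k)] with s hs
    rw [norm_pow]
    exact pow_le_pow_left₀ (norm_nonneg _)
      (norm_coulombPhase_le hγ hk1 hρ0 (hρ0.trans_le hs) (by simp)) 2
  have key : ∀ {y : ℝ → ℂ} {l : ℂ}, Tendsto (fun r => y r / F r) atTop (𝓝 l) →
      Tendsto (fun r => f r * y r) atTop (𝓝 0) := fun {y l} hy => by
    have h0 : Tendsto (fun r => f r / F r * (y r / F r)) atTop (𝓝 0) := by simpa using hf.mul hy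
    refine (h0.zero_mul_isBoundedUnder_le hbdd).congr fun r => ?_
    have := hF0 r
    field_simp
  have hW0 : W = 0 := by
    refine eq_zero_of_tendsto_of_tendsto_deriv
      (fun r hr => (h r hr).1.mul (h₁ r hr).1) (key hf₁) ?_
    have h2 : Tendsto (fun r => W + 2 * (f r * g₁ r)) atTop (𝓝 W) := by
      simpa using ((key hg₁).const_mul 2).const_add W
    refine h2.congr' ?_
    filter_upwards [eventually_gt_atTop 0] with r hr
    rw [← hW r hr]
    ring
  obtain ⟨R, hR, hfR⟩ : ∃ R, 0 < R ∧ f₁ R ≠ 0 := by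
    obtain ⟨R, h1, h2⟩ := ((hf₁.eventually_ne one_ne_zero).and (eventually_gt_atTop 0)).exists
    exact ⟨R, h2, fun h0 => h1 (by rw [h0, zero_div])⟩
  have hprop : ∀ s, 0 < s → f s = f R / f₁ R * f₁ s := fun s hs => by
    refine sub_eq_zero.1 ((h.sub (h₁.const_mul (f R / f₁ R))).eq_zero_of_initial hR ?_ ?_ hs)
    · field_simp
      simp
    · have h3 := hW R hR
      rw [hW0] at h3
      field_simp
      linear_combination h3
  have hc : f R / f₁ R = 0 := by
    refine tendsto_nhds_unique ?_ hf
    have h2 := hf₁.const_mul (f R / f₁ R)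
    rw [mul_one] at h2
    refine h2.congr' ?_
    filter_upwards [eventually_gt_atTop 0] with s hs
    rw [hprop s hs, mul_div_assoc]
  rw [hprop r hr, hc, zero_mul]

end Uniqueness

section Kodaira

variable {γ : ℝ} {k : ℂ}

theorem exp_neg_eq_inv_coulombPhase (γ : ℝ) (k : ℂ) (r : ℝ) :
    Complex.exp (-(Complex.I * k * (r : ℂ)) - Complex.I * ((γ : ℂ) / k) * (Real.log r : ℂ)) =
      (coulombPhase γ k r)⁻¹ := by
  rw [coulombPhase, ← Complex.exp_neg]
  congr 1
  ring

theorem IsKodaira.isCoulombPair {u : ℝ → ℂ} (hu : IsKodaira γ k u) :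
    IsCoulombPair γ k (fun r => u r * (r : ℂ)) (fun r => deriv u r * (r : ℂ) + u r) := by
  obtain ⟨hs, hode, -⟩ := hu
  rw [contDiffOn_infty_iff_deriv_of_isOpen isOpen_Ioi] at hs
  obtain ⟨hs0, hs1⟩ := hs
  rw [contDiffOn_infty_iff_deriv_of_isOpen isOpen_Ioi] at hs1
  intro r hr
  have h1 : HasDerivAt (fun x : ℝ => (x : ℂ)) 1 r := Complex.ofRealCLM.hasDerivAt
  have hu : HasDerivAt u (deriv u r) r := (hs0.differentiableAt (Ioi_mem_nhds hr)).hasDerivAt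
  have hu' : HasDerivAt (deriv u) (deriv (deriv u) r) r :=
    (hs1.1.differentiableAt (Ioi_mem_nhds hr)).hasDerivAt
  refine ⟨(hu.mul h1).congr_deriv (by ring), ((hu'.mul h1).add hu).congr_deriv ?_⟩
  have h := hode r hr
  have hr' : (r : ℂ) ≠ 0 := by exact_mod_cast hr.ne'
  push_cast at h
  field_simp at h ⊢
  linear_combination -h

theorem contDiffOn_ofReal_inv : ContDiffOn ℝ (⊤ : ℕ∞) (fun r : ℝ => (r : ℂ)⁻¹) (Ioi 0) :=
  Complex.ofRealCLM.contDiff.contDiffOn.inv fun _ hr => Complex.ofReal_ne_zero.2 (ne_of_gt hr)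

theorem IsCoulombPair.contDiffOn {f g : ℝ → ℂ} (h : IsCoulombPair γ k f g) :
    ContDiffOn ℝ (⊤ : ℕ∞) f (Ioi 0) := by
  have hV : ContDiffOn ℝ (⊤ : ℕ∞) (fun r : ℝ => -(k ^ 2 + 2 * (γ : ℂ) / (r : ℂ))) (Ioi 0) :=
    (contDiffOn_const.add (contDiffOn_const.mul contDiffOn_ofReal_inv)).neg
  have key : ∀ n : ℕ, ContDiffOn ℝ n f (Ioi 0) ∧ ContDiffOn ℝ n g (Ioi 0) := by
    intro n
    induction n with
    | zero =>
      simp only [Nat.cast_zero, contDiffOn_zero]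
      exact ⟨fun r hr => (h r hr).1.continuousAt.continuousWithinAt,
        fun r hr => (h r hr).2.continuousAt.continuousWithinAt⟩
    | succ n ih =>
      push_cast
      rw [contDiffOn_succ_iff_deriv_of_isOpen isOpen_Ioi,
        contDiffOn_succ_iff_deriv_of_isOpen isOpen_Ioi]
      refine ⟨⟨fun r hr => (h r hr).1.differentiableAt.differentiableWithinAt, by simp,
        ih.2.congr fun r hr => (h r hr).1.deriv⟩,
        fun r hr => (h r hr).2.differentiableAt.differentiableWithinAt, by simp,
        ((hV.of_le (by exact_mod_cast le_top)).mul ih.1).congr fun r hr => (h r hr).2.deriv⟩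
  exact contDiffOn_infty.2 fun n => (key n).1

theorem IsCoulombPair.isKodaira {f g : ℝ → ℂ} (h : IsCoulombPair γ k f g)
    (hlim : Tendsto (fun r => f r / coulombPhase γ k r) atTop (𝓝 1)) :
    IsKodaira γ k (fun r => f r / (r : ℂ)) := by
  have hne : ∀ r : ℝ, 0 < r → (r : ℂ) ≠ 0 := fun r hr => by exact_mod_cast hr.ne'
  have hof : ∀ r : ℝ, HasDerivAt (fun x : ℝ => (x : ℂ)) 1 r := fun _ =>
    Complex.ofRealCLM.hasDerivAt
  have hd : ∀ r : ℝ, 0 < r →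
      HasDerivAt (fun r => f r / (r : ℂ)) (g r / (r : ℂ) - f r / (r : ℂ) ^ 2) r := fun r hr => by
    refine ((h r hr).1.div (hof r) (hne r hr)).congr_deriv ?_
    have := hne r hr
    field_simp
  refine ⟨h.contDiffOn.mul contDiffOn_ofReal_inv, fun r hr => ?_, ?_⟩
  · have hr' := hne r hr
    have hdd : HasDerivAt (deriv fun r => f r / (r : ℂ)) _ r :=
      (((h r hr).2.div (hof r) hr').sub
        ((h r hr).1.div ((hof r).pow 2) (pow_ne_zero 2 hr'))).congr_of_eventuallyEq <| by
        filter_upwards [Ioi_mem_nhds hr] with x hx using (hd x hx).deriv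
    rw [hdd.deriv, (hd r hr).deriv]
    simp only [Pi.pow_apply]
    push_cast
    field_simp
    ring
  · refine hlim.congr' ?_
    filter_upwards [eventually_gt_atTop 0] with r hr
    rw [exp_neg_eq_inv_coulombPhase, div_mul_cancel₀ _ (hne r hr), div_eq_mul_inv]

end Kodaira

/-- For `Im k ≥ 0`, `k ≠ 0`, there is a unique Kodaira solution for parameter `k`
(unique as a function on `(0,∞)`). -/
theorem kodaira_solution_exists_unique (γ : ℝ) (hγ : 0 < γ)
    (k : ℂ) (hk1 : 0 ≤ k.im) (hk2 : k ≠ 0) :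
    (∃ u : ℝ → ℂ, IsKodaira γ k u) ∧
    (∀ u v : ℝ → ℂ, IsKodaira γ k u → IsKodaira γ k v → ∀ r : ℝ, 0 < r → u r = v r) := by
  refine ⟨?_, fun u v hu hv r hr => ?_⟩
  · obtain ⟨f, g, h, hf, -⟩ := exists_isCoulombPair hγ hk1 hk2
    exact ⟨_, h.isKodaira hf⟩
  · have hlim := hu.2.2.sub hv.2.2
    rw [sub_self] at hlim
    have h0 := (hu.isCoulombPair.sub hv.isCoulombPair).eq_zero_of_tendsto hγ hk1 hk2
      (hlim.congr fun s => by rw [exp_neg_eq_inv_coulombPhase]; ring) hr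
    have hr' : (r : ℂ) ≠ 0 := by exact_mod_cast hr.ne'
    exact mul_right_cancel₀ hr' (sub_eq_zero.1 h0)
end
end
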